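/- arXiv:1112.1467 — 2 statements merged into one kernel-verified Lean document; each statement's English description precedes it below -/
import Mathlib

section
/- Let p ≥ 5 be a prime and let 3 ≤ k ≤ p. Let V be a finite elementary abelian p-group and G a finite p-group acting faithfully on V. If V is both a PS-module of degree k for G and an F-module for G, then the Baumann subgroup Baum(G) = C_G(Ω₁Z(J_e(G))) is a proper subgroup of G. -/
/-!
STATEMENT 1 (module-theoretic form of Theorem B):
Let `p ≥ 5` be a prime and `3 ≤ k ≤ p`.  Let `V` be a finite elementary abelian
`p`-group and `G` a finite `p`-group acting faithfully on `V`.  If `V` is both a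
PS-module of degree `k` for `G` and an F-module for `G`, then the Baumann subgroup
`Baum(G) = C_G(Ω₁Z(J_e(G)))` is a proper subgroup of `G`.
-/

section Defs

variable (p : ℕ) {G : Type} [Group G]

/-- `E` is an elementary abelian subgroup of `G` (abelian with exponent dividing `p`). -/
def IsElemAbelian (E : Subgroup G) : Prop :=
  (∀ x ∈ E, ∀ y ∈ E, x * y = y * x) ∧ ∀ x ∈ E, x ^ p = 1

/-- The Thompson subgroup `J_e(G)`: the subgroup generated by the elementary abelian
subgroups of `G` of maximum order. -/
def ThompsonJe : Subgroup G :=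
  sSup {E : Subgroup G | IsElemAbelian p E ∧
    ∀ F : Subgroup G, IsElemAbelian p F → Nat.card F ≤ Nat.card E}

/-- `Ω₁` of the center of a subgroup `H ≤ G`, as a subgroup of `G`: the subgroup
generated by the elements `x` of `Z(H) = H ∩ C_G(H)` with `x ^ p = 1`. -/
def Omega1Center (H : Subgroup G) : Subgroup G :=
  Subgroup.closure {x : G | x ∈ H ⊓ Subgroup.centralizer (H : Set G) ∧ x ^ p = 1}

/-- The Baumann subgroup `Baum(G) = C_G(Ω₁Z(J_e(G)))`. -/
def Baumann : Subgroup G :=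
  Subgroup.centralizer ((Omega1Center p (ThompsonJe p) : Subgroup G) : Set G)

end Defs

theorem quadratic_of_three_quadratics {S : Type*} [CommRing S] {X C : S}
    (h2 : ∀ r : S, 2 * r = 0 → r = 0) (hX : (X - 1) ^ 2 = 0) (hXC : (X * C - 1) ^ 2 = 0)
    (hXCC : (X * C * C - 1) ^ 2 = 0) : (C - 1) ^ 2 = 0 := by
  obtain ⟨n, rfl⟩ : ∃ n, X = 1 + n := ⟨X - 1, by ring⟩
  obtain ⟨m, hm⟩ : ∃ m, (1 + n) * C = 1 + m := ⟨(1 + n) * C - 1, by ring⟩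
  have hn : n ^ 2 = 0 := by simpa using hX
  have hm2 : m ^ 2 = 0 := by simpa [hm] using hXC
  have hC : C = (1 - n) * (1 + m) := by linear_combination (1 - n) * hm + C * hn
  have hCC : (1 + n) * C * C - 1 = 2 * m - n - 2 * (m * n) := by
    rw [hm]; nth_rewrite 1 [hC]; linear_combination (1 - n) * hm2
  have hmn : m * n = 0 := by
    apply h2
    apply h2
    rw [hCC] at hXCC
    linear_combination -hXCC + (4 - 8 * n + 4 * n ^ 2) * hm2 + (1 + 4 * m) * hn
  rw [hC]
  linear_combination (1 - 2 * n + n ^ 2) * hm2 + (1 + 2 * m) * hn - 2 * hmn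

open scoped IsMulCommutative in
theorem quadratic_of_commute {R : Type*} [Ring R] {X C : R} (hc : Commute X C)
    (h2 : ∀ r : R, 2 * r = 0 → r = 0) (hX : (X - 1) ^ 2 = 0) (hXC : (X * C - 1) ^ 2 = 0)
    (hXCC : (X * C * C - 1) ^ 2 = 0) : (C - 1) ^ 2 = 0 := by
  have hcomm : ∀ x ∈ ({X, C} : Set R), ∀ y ∈ ({X, C} : Set R), x * y = y * x := by
    rintro x (rfl | rfl) y (rfl | rfl)
    exacts [rfl, hc.eq, hc.eq.symm, rfl]
  have := Subring.isMulCommutative_closure hcomm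
  let X' : Subring.closure ({X, C} : Set R) := ⟨X, Subring.subset_closure (by simp)⟩
  let C' : Subring.closure ({X, C} : Set R) := ⟨C, Subring.subset_closure (by simp)⟩
  have key : (C' - 1) ^ 2 = 0 := by
    apply quadratic_of_three_quadratics (X := X') (C := C')
    · exact fun r hr => Subtype.ext (h2 r (congrArg Subtype.val hr))
    all_goals exact Subtype.ext ‹_›
  exact congrArg Subtype.val key

theorem sub_one_pow_prime_pow {R : Type*} [Ring R] {p : ℕ} [Fact p.Prime] (hp : (p : R) = 0)
    (x : R) (k : ℕ) : (x - 1) ^ p ^ k = x ^ p ^ k - 1 := by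
  rcases subsingleton_or_nontrivial R with h | h
  · exact Subsingleton.elim _ _
  · have : CharP R p := by
      rw [← CharP.ringChar_of_prime_eq_zero (Fact.out : p.Prime) hp]; infer_instance
    simpa using sub_pow_char_pow_of_commute (p := p) (n := k) (Commute.one_right x)

section Quadratic

variable {G R : Type*} [Group G] [Ring R] (φ : G →* R)

/-- `g` acts quadratically through `φ`. -/
def IsQuadratic (g : G) : Prop := (φ g - 1) ^ 2 = 0

variable {φ}

theorem IsQuadratic.conj {a : G} (ha : IsQuadratic φ a) (g : G) :
    IsQuadratic φ (g * a * g⁻¹) := by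
  have h1 : φ g * φ g⁻¹ = 1 := by rw [← map_mul]; simp
  have h2 : φ g⁻¹ * φ g = 1 := by rw [← map_mul]; simp
  have h3 : φ (g * a * g⁻¹) - 1 = φ g * (φ a - 1) * φ g⁻¹ := by
    simp only [map_mul, mul_sub, sub_mul, mul_one, h1]
  have ha' : (φ a - 1) * (φ a - 1) = 0 := by rw [← sq]; exact ha
  rw [IsQuadratic, h3, sq]
  calc _ = φ g * (φ a - 1) * (φ g⁻¹ * φ g) * (φ a - 1) * φ g⁻¹ := by noncomm_ring
    _ = φ g * ((φ a - 1) * (φ a - 1)) * φ g⁻¹ := by rw [h2]; noncomm_ring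
    _ = 0 := by rw [ha']; simp

theorem IsQuadratic.of_conj_eq_mul (h2 : ∀ r : R, 2 * r = 0 → r = 0) {a b c : G}
    (ha : IsQuadratic φ a) (hab : b * a * b⁻¹ = a * c) (hac : Commute a c) (hbc : Commute b c) :
    IsQuadratic φ c := by
  have h1 : IsQuadratic φ (a * c) := hab ▸ ha.conj b
  have h3 : IsQuadratic φ (a * c * c) := by
    have : b * (a * c) * b⁻¹ = a * c * c := by
      calc b * (a * c) * b⁻¹ = b * a * (c * b⁻¹) := by group
        _ = b * a * (b⁻¹ * c) := by rw [hbc.inv_left.eq]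
        _ = b * a * b⁻¹ * c := by group
        _ = a * c * c := by rw [hab]
    exact this ▸ h1.conj b
  refine quadratic_of_commute (X := φ a) (hac.map φ) h2 ha ?_ ?_
  · simpa [IsQuadratic] using h1
  · simpa [IsQuadratic] using h3

theorem IsQuadratic.pow_eq_one {p : ℕ} [Fact p.Prime] (hR : (p : R) = 0)
    (hφ : Function.Injective φ) {a : G} (ha : IsQuadratic φ a) : a ^ p = 1 := by
  apply hφ
  have h := sub_one_pow_prime_pow hR (φ a) 1
  have h0 : (φ a - 1) ^ p = 0 := pow_eq_zero_of_le (Fact.out : p.Prime).two_le ha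
  rw [pow_one, h0] at h
  rw [map_pow, map_one]
  exact (sub_eq_zero.mp h.symm)

/-- A finite `p`-group with two noncommuting quadratic elements has a nontrivial quadratic
element in its derived subgroup. -/
theorem exists_isQuadratic_mem_commutator {p : ℕ} [Fact p.Prime]
    (h2 : ∀ r : R, 2 * r = 0 → r = 0) (n : ℕ) :
    ∀ (G : Type*) [Group G] [Finite G], IsPGroup p G → Nat.card G = n → ∀ (φ : G →* R) (a b : G),
      IsQuadratic φ a → IsQuadratic φ b → ¬ Commute a b →
        ∃ c ∈ commutator G, c ≠ 1 ∧ IsQuadratic φ c := by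
  induction n using Nat.strong_induction_on with
  | _ n ih =>
  intro G _ _ hG hn φ a b ha hb hab
  by_cases hM : ∃ M : Subgroup G, M ≠ ⊤ ∧ ∃ x ∈ M, ∃ y ∈ M,
      IsQuadratic φ x ∧ IsQuadratic φ y ∧ ¬ Commute x y
  · obtain ⟨M, hMt, x, hx, y, hy, hqx, hqy, hxy⟩ := hM
    have hlt : Nat.card M < n := by
      refine lt_of_le_of_ne (hn ▸ Subgroup.card_le_card_group M) fun h => hMt ?_
      exact Subgroup.eq_top_of_card_eq M (h.trans hn.symm)
    obtain ⟨c, hc, hc1, hqc⟩ := ih _ hlt M (hG.to_subgroup M) rfl (φ.comp M.subtype)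
      ⟨x, hx⟩ ⟨y, hy⟩ hqx hqy fun h => hxy (congrArg Subtype.val h.eq)
    refine ⟨c, ?_, fun h => hc1 (Subtype.ext h), hqc⟩
    have : (c : G) ∈ (commutator M).map M.subtype := ⟨c, hc, rfl⟩
    rw [commutator_def, Subgroup.map_commutator] at this
    exact Subgroup.commutator_mono le_top le_top this
  · push Not at hM
    have hnil : Group.IsNilpotent G := hG.isNilpotent
    have key : ∀ x y g : G, ¬ Commute x y → IsQuadratic φ x → Commute x (g * x * g⁻¹) := by
      intro x y g hxy hqx
      have hne : Subgroup.zpowers x ≠ ⊤ := by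
        intro h
        have hy : y ∈ Subgroup.zpowers x := h ▸ Subgroup.mem_top y
        obtain ⟨k, rfl⟩ := hy
        exact hxy ((Commute.refl x).zpow_right k)
      obtain ⟨M, hM1, hM2⟩ := (eq_top_or_exists_le_coatom (Subgroup.zpowers x)).resolve_left hne
      have hxM : x ∈ M := hM2 (Subgroup.mem_zpowers x)
      have hnorm : M.Normal :=
        Subgroup.NormalizerCondition.normal_of_coatom M Group.normalizerCondition_of_isNilpotent hM1
      exact hM M hM1.1 x hxM _ (hnorm.conj_mem x hxM g) hqx (hqx.conj g)
    have hA : Commute a (b * a * b⁻¹) := key a b b hab ha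
    have hB : Commute b (a⁻¹ * b * a) := by
      simpa using key b a a⁻¹ (fun h => hab h.symm) hb
    refine ⟨a⁻¹ * (b * a * b⁻¹), ?_, ?_, ?_⟩
    · have := Subgroup.commutator_mem_commutator (Subgroup.mem_top a⁻¹) (Subgroup.mem_top b)
      rw [commutatorElement_def] at this
      rw [commutator_def]
      convert this using 1
      group
    · intro h
      apply hab
      have h' : a = b * a * b⁻¹ := (inv_mul_eq_one.mp h)
      calc a * b = (b * a * b⁻¹) * b := by rw [← h']
        _ = b * a := by group
    · refine ha.of_conj_eq_mul h2 (b := b) (by group) ?_ ?_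
      · exact ((Commute.refl a).inv_right).mul_right hA
      · have : a⁻¹ * (b * a * b⁻¹) = (a⁻¹ * b * a) * b⁻¹ := by group
        rw [this]
        exact hB.mul_right ((Commute.refl b).inv_right)

end Quadratic

section Replacement

variable {W H : Type*} [AddCommGroup W] [Group H] (φ : H →* AddMonoid.End W) (E : Subgroup H)

/-- The vectors fixed by every element of `E`. -/
def fixedVectors : AddSubgroup W where
  carrier := {w | ∀ a ∈ E, φ a w = w}
  zero_mem' := fun a _ => map_zero (φ a)
  add_mem' := fun hx hy a ha => by rw [map_add, hx a ha, hy a ha]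
  neg_mem' := fun hx a ha => by rw [map_neg, hx a ha]

variable {φ E} in
theorem mem_fixedVectors {w : W} : w ∈ fixedVectors φ E ↔ ∀ a ∈ E, φ a w = w := Iff.rfl

theorem end_map_mul_apply (a b : H) (w : W) : φ (a * b) w = φ a (φ b w) := by
  rw [map_mul]; rfl

theorem end_map_inv_apply_apply (a : H) (w : W) : φ a⁻¹ (φ a w) = w := by
  rw [← end_map_mul_apply, inv_mul_cancel, map_one]; rfl

/-- The elements `a` of `E` such that `[v, a]` is fixed by `E`. -/
def commutatorFixer (v : W) : Subgroup H where
  carrier := {a | a ∈ E ∧ φ a v - v ∈ fixedVectors φ E}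
  one_mem' := ⟨E.one_mem, by simp [(fixedVectors φ E).zero_mem]⟩
  mul_mem' := by
    rintro a b ⟨ha, ha'⟩ ⟨hb, hb'⟩
    refine ⟨E.mul_mem ha hb, ?_⟩
    have : φ (a * b) v - v = (φ b v - v) + (φ a v - v) := by
      rw [← mem_fixedVectors.mp hb' a ha, end_map_mul_apply, map_sub]; abel
    rw [this]
    exact add_mem hb' ha'
  inv_mem' := by
    rintro a ⟨ha, ha'⟩
    refine ⟨E.inv_mem ha, ?_⟩
    have : φ a⁻¹ v - v = -(φ a v - v) := by
      rw [← mem_fixedVectors.mp ha' a⁻¹ (E.inv_mem ha), map_sub, end_map_inv_apply_apply]; abel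
    rw [this]
    exact neg_mem ha'

/-- The subgroup generated by `[v, E]` and the fixed vectors of `E`. -/
def commutatorSpan (v : W) : AddSubgroup W :=
  AddSubgroup.closure {w | ∃ b ∈ E, w = φ b v - v} ⊔ fixedVectors φ E

theorem card_mul_card_fixedVectors_le [Finite W] [Finite H] (v : W) :
    Nat.card E * Nat.card (fixedVectors φ E) ≤
      Nat.card (commutatorFixer φ E v) * Nat.card (commutatorSpan φ E v) := by
  set D := commutatorFixer φ E v
  set S := commutatorSpan φ E v
  set F := fixedVectors φ E
  have hDE : D ≤ E := fun a ha => ha.1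
  have hFS : F ≤ S := le_sup_right
  have hmem : ∀ a : E, φ a v - v ∈ S := fun a =>
    le_sup_left (a := AddSubgroup.closure {w | ∃ b ∈ E, w = φ b v - v})
      (AddSubgroup.subset_closure ⟨a, a.2, rfl⟩)
  have h1 : Nat.card D * D.relIndex E = Nat.card E := by
    simpa using Subgroup.relIndex_mul_relIndex ⊥ D E bot_le hDE
  have h2 : Nat.card F * F.relIndex S = Nat.card S := by
    simpa using AddSubgroup.relIndex_mul_relIndex ⊥ F S bot_le hFS
  have key : ∀ a b : E, a⁻¹ * b ∈ D.subgroupOf E ↔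
      (-(⟨φ a v - v, hmem a⟩ : S) + ⟨φ b v - v, hmem b⟩) ∈ F.addSubgroupOf S := by
    intro a b
    have hx : φ ((a : H)⁻¹ * b) v - v = φ (a : H)⁻¹ (-(φ a v - v) + (φ b v - v)) := by
      rw [end_map_mul_apply, map_add, map_neg, map_sub, map_sub, end_map_inv_apply_apply]; abel
    rw [Subgroup.mem_subgroupOf, AddSubgroup.mem_addSubgroupOf]
    change ((a : H)⁻¹ * b ∈ E ∧ φ ((a : H)⁻¹ * b) v - v ∈ F) ↔ -(φ a v - v) + (φ b v - v) ∈ F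
    rw [hx]
    constructor
    · rintro ⟨-, h⟩
      have h' := h a a.2
      rw [← end_map_mul_apply, mul_inv_cancel, map_one] at h'
      rw [← h'] at h
      exact h
    · intro h
      refine ⟨(a⁻¹ * b).2, ?_⟩
      rw [h _ (E.inv_mem a.2)]
      exact h
  have h3 : D.relIndex E ≤ F.relIndex S := by
    let f : E ⧸ D.subgroupOf E → S ⧸ F.addSubgroupOf S :=
      Quotient.map' (fun a => ⟨φ a v - v, hmem a⟩) fun a b hab => by
        rw [QuotientGroup.leftRel_apply, key] at hab
        rwa [QuotientAddGroup.leftRel_apply]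
    refine Nat.card_le_card_of_injective f ?_
    rintro ⟨a⟩ ⟨b⟩ hab
    refine Quotient.sound' ?_
    rw [QuotientGroup.leftRel_apply, key]
    exact QuotientAddGroup.leftRel_apply.mp (Quotient.exact' hab)
  rw [← h1, ← h2]
  calc _ = Nat.card D * (Nat.card F * D.relIndex E) := by ring
    _ ≤ _ := by gcongr

theorem commutatorSpan_le_fixedVectors (hE : ∀ x ∈ E, ∀ y ∈ E, x * y = y * x) (v : W) :
    commutatorSpan φ E v ≤ fixedVectors φ (commutatorFixer φ E v) := by
  refine sup_le ((AddSubgroup.closure_le _).mpr ?_) fun w hw a ha => hw a ha.1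
  rintro _ ⟨b, hb, rfl⟩ a ⟨ha, ha'⟩
  have h := ha' b hb
  rw [map_sub, ← end_map_mul_apply, hE b hb a ha, end_map_mul_apply] at h
  rw [map_sub, sub_eq_sub_iff_add_eq_add]
  rw [sub_eq_sub_iff_add_eq_add] at h
  rw [h, add_comm]

/-- A `p`-group acts nilpotently, so `v` lies in the span of `[v, E]` and the fixed vectors only
if it is itself fixed. -/
theorem mem_fixedVectors_of_mem_commutatorSpan {p : ℕ} [Fact p.Prime] (hH : IsPGroup p H)
    (hW : ∀ w : W, p • w = 0) (hE : ∀ x ∈ E, ∀ y ∈ E, x * y = y * x) {v : W}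
    (hv : v ∈ commutatorSpan φ E v) : v ∈ fixedVectors φ E := by
  have hp : (p : AddMonoid.End W) = 0 := by
    ext w; simpa using hW w
  obtain ⟨m, hm, c, hc, hmc⟩ := AddSubgroup.mem_sup.mp hv
  have hcomm : ∀ x ∈ φ '' (E : Set H), ∀ y ∈ φ '' (E : Set H), x * y = y * x := by
    rintro _ ⟨a, ha, rfl⟩ _ ⟨b, hb, rfl⟩
    rw [← map_mul, ← map_mul, hE a ha b hb]
  have := Subring.isMulCommutative_closure hcomm
  have hsub : ∀ a ∈ E, φ a ∈ Subring.closure (φ '' (E : Set H)) := fun a ha =>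
    Subring.subset_closure ⟨a, ha, rfl⟩
  have hex : ∀ m ∈ AddSubgroup.closure {w | ∃ b ∈ E, w = φ b v - v},
      ∃ y ∈ Subring.closure (φ '' (E : Set H)), IsNilpotent y ∧ y v = m := by
    intro m hm
    induction hm using AddSubgroup.closure_induction with
    | mem x hx =>
      obtain ⟨b, hb, rfl⟩ := hx
      refine ⟨φ b - 1, sub_mem (hsub b hb) (one_mem _), ?_, rfl⟩
      obtain ⟨k, hk⟩ := hH b
      refine ⟨p ^ k, ?_⟩
      rw [sub_one_pow_prime_pow hp, ← map_pow, hk, map_one, sub_self]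
    | zero => exact ⟨0, zero_mem _, IsNilpotent.zero, rfl⟩
    | add x z _ _ hx hz =>
      obtain ⟨y₁, h₁, hn₁, rfl⟩ := hx
      obtain ⟨y₂, h₂, hn₂, rfl⟩ := hz
      have hcom : Commute y₁ y₂ := setLike_mul_comm h₁ h₂
      exact ⟨y₁ + y₂, add_mem h₁ h₂, hcom.isNilpotent_add hn₁ hn₂, rfl⟩
    | neg x _ hx =>
      obtain ⟨y, h, hn, rfl⟩ := hx
      exact ⟨-y, neg_mem h, hn.neg, rfl⟩
  obtain ⟨y, hy, hyn, rfl⟩ := hex m hm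
  obtain ⟨u, hu⟩ := hyn.isUnit_one_sub
  have hvc : (1 - y) v = c := by
    change v - y v = c
    rw [sub_eq_iff_eq_add', hmc]
  intro b hb
  have hby : φ b * (1 - y) = (1 - y) * φ b :=
    setLike_mul_comm (hsub b hb) (sub_mem (one_mem _) hy)
  have h1 : (1 - y) (φ b v) = (1 - y) v := by
    calc (1 - y) (φ b v) = ((1 - y) * φ b) v := rfl
      _ = φ b ((1 - y) v) := by rw [← hby]; rfl
      _ = (1 - y) v := by rw [hvc]; exact hc b hb
  calc φ b v = ((↑u⁻¹ : AddMonoid.End W) * (1 - y)) (φ b v) := by rw [← hu, u.inv_mul]; rfl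
    _ = (↑u⁻¹ : AddMonoid.End W) ((1 - y) (φ b v)) := rfl
    _ = (↑u⁻¹ : AddMonoid.End W) ((1 - y) v) := by rw [h1]
    _ = ((↑u⁻¹ : AddMonoid.End W) * (1 - y)) v := rfl
    _ = v := by rw [← hu, u.inv_mul]; rfl

/-- An element-wise form of the Timmesfeld replacement theorem: an offender contains an element
acting quadratically and nontrivially. -/
theorem exists_quadratic_of_offender {p : ℕ} [Fact p.Prime] [Finite W] [Finite H]
    (hH : IsPGroup p H) (hW : ∀ w : W, p • w = 0) (hE : ∀ x ∈ E, ∀ y ∈ E, x * y = y * x)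
    (hne : ∃ a ∈ E, φ a ≠ 1)
    (hcard : Nat.card W * Nat.card (E ⊓ φ.ker : Subgroup H) ≤
      Nat.card E * Nat.card (fixedVectors φ E)) :
    ∃ x ∈ E, φ x ≠ 1 ∧ IsQuadratic φ x := by
  induction hn : Nat.card E using Nat.strong_induction_on generalizing E with
  | _ n ih =>
  by_cases hall : ∀ v : W, commutatorFixer φ E v = E
  · obtain ⟨a, ha, ha1⟩ := hne
    refine ⟨a, ha, ha1, ?_⟩
    ext v
    have hv : a ∈ commutatorFixer φ E v := (hall v).symm ▸ ha
    rw [sq]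
    change φ a (φ a v - v) - (φ a v - v) = 0
    rw [hv.2 a ha, sub_self]
  · push Not at hall
    obtain ⟨v, hv⟩ := hall
    have hDE : commutatorFixer φ E v ≤ E := fun a ha => ha.1
    have hker : E ⊓ φ.ker ≤ commutatorFixer φ E v := by
      rintro a ⟨ha, ha'⟩
      refine ⟨ha, ?_⟩
      rw [MonoidHom.mem_ker.mp ha']
      change v - v ∈ _
      simp [(fixedVectors φ E).zero_mem]
    have hle := hcard.trans (card_mul_card_fixedVectors_le φ E v)
    by_cases hD : ∃ a ∈ commutatorFixer φ E v, φ a ≠ 1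
    · have hlt : Nat.card (commutatorFixer φ E v) < n := by
        refine lt_of_le_of_ne (hn ▸ Subgroup.card_le_of_le hDE) fun h => hv ?_
        exact Subgroup.eq_of_le_of_card_ge hDE (hn.trans h.symm).le
      have hK : commutatorFixer φ E v ⊓ φ.ker = E ⊓ φ.ker :=
        le_antisymm (inf_le_inf_right _ hDE) (le_inf hker inf_le_right)
      obtain ⟨x, hx, hx'⟩ := ih _ hlt (commutatorFixer φ E v)
        (fun x hx y hy => hE x (hDE hx) y (hDE hy)) hD (by
          rw [hK]
          refine hle.trans (Nat.mul_le_mul_left _ ?_)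
          exact Nat.card_le_card_of_injective _
            (AddSubgroup.inclusion_injective (commutatorSpan_le_fixedVectors φ E hE v))) rfl
      exact ⟨x, hDE hx, hx'⟩
    · push Not at hD
      exfalso
      have hK : commutatorFixer φ E v = E ⊓ φ.ker :=
        le_antisymm (fun a ha => ⟨hDE ha, hD a ha⟩) hker
      rw [hK, mul_comm] at hle
      have htop : commutatorSpan φ E v = ⊤ :=
        AddSubgroup.eq_top_of_le_card _ (Nat.le_of_mul_le_mul_left hle Nat.card_pos)
      have hfix := mem_fixedVectors_of_mem_commutatorSpan φ E hH hW hE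
        (htop ▸ AddSubgroup.mem_top v)
      refine hv (le_antisymm hDE fun a ha => ⟨ha, ?_⟩)
      rw [hfix a ha, sub_self]
      exact zero_mem _

end Replacement

section MinimalNormal

open scoped commutatorElement

variable {G R : Type*} [Group G] [Finite G] [Ring R] {φ : G →* R} {p : ℕ} [Fact p.Prime]

theorem commutator_top_lt (hG : IsPGroup p G) {K : Subgroup G} [hK : K.Normal] (hne : K ≠ ⊥) :
    ⁅K, (⊤ : Subgroup G)⁆ < K := by
  refine lt_of_le_of_ne (Subgroup.commutator_le_left K ⊤) fun h => hne ?_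
  have hnil : Group.IsNilpotent G := hG.isNilpotent
  obtain ⟨n, hn⟩ := Subgroup.nilpotent_iff_lowerCentralSeries.mp hnil
  rw [← le_bot_iff, ← hn]
  clear hn
  induction n with
  | zero => exact le_top
  | succ n ih =>
    rw [← h]
    exact Subgroup.commutator_mono ih le_rfl

/-- If `G` has a nontrivial quadratic element, then some nontrivial elementary abelian normal
subgroup `K` is generated by quadratic elements, and no element of `G` acts quadratically and
nontrivially on `K` by conjugation. -/
theorem exists_normal_generated_by_quadratic (hG : IsPGroup p G) (hR : (p : R) = 0)
    (h2 : ∀ r : R, 2 * r = 0 → r = 0) (hφ : Function.Injective φ)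
    (hex : ∃ a : G, a ≠ 1 ∧ IsQuadratic φ a) :
    ∃ K : Subgroup G, K.Normal ∧ (∃ a ∈ K, a ≠ 1 ∧ IsQuadratic φ a) ∧
      (∀ x ∈ K, ∀ y ∈ K, x * y = y * x) ∧ (∀ x ∈ K, x ^ p = 1) ∧
      ∀ g : G, (∀ w ∈ K, Commute g ⁅w, g⁆) → ∀ w ∈ K, Commute g w := by
  obtain ⟨a₀, ha₀, hq₀⟩ := hex
  obtain ⟨K, -, hmin⟩ := exists_minimal_le_of_wellFoundedLT
    (fun K : Subgroup G => K.Normal ∧ ∃ a ∈ K, a ≠ 1 ∧ IsQuadratic φ a) ⊤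
    ⟨inferInstance, a₀, Subgroup.mem_top _, ha₀, hq₀⟩
  obtain ⟨⟨hN, a, haK, ha1, haq⟩, hmin⟩ := hmin
  have hcl : Subgroup.normalClosure {a} = K := by
    have hle : Subgroup.normalClosure {a} ≤ K :=
      Subgroup.normalClosure_le_normal (Set.singleton_subset_iff.mpr haK)
    refine le_antisymm hle (hmin ⟨inferInstance, a, ?_, ha1, haq⟩ hle)
    exact Subgroup.subset_normalClosure rfl
  have hconj : ∀ x ∈ Group.conjugatesOfSet {a}, x ∈ K ∧ IsQuadratic φ x := by
    intro x hx
    obtain ⟨b, hb, hbx⟩ := Group.mem_conjugatesOfSet_iff.mp hx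
    obtain rfl : b = a := hb
    obtain ⟨c, rfl⟩ := isConj_iff.mp hbx
    exact ⟨hN.conj_mem b haK c, haq.conj c⟩
  have hcomm1 : ∀ x ∈ ⁅K, (⊤ : Subgroup G)⁆, IsQuadratic φ x → x = 1 := by
    intro x hx hxq
    by_contra hx1
    have hlt := commutator_top_lt hG (K := K) fun h => ha1 (by rwa [h, Subgroup.mem_bot] at haK)
    exact hlt.not_ge (hmin ⟨inferInstance, x, hx, hx1, hxq⟩ hlt.le)
  have hquad : ∀ x ∈ K, ∀ y ∈ K, IsQuadratic φ x → IsQuadratic φ y → Commute x y := by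
    intro x hx y hy hxq hyq
    by_contra hxy
    obtain ⟨c, hc, hc1, hcq⟩ := exists_isQuadratic_mem_commutator h2 _ K (hG.to_subgroup K) rfl
      (φ.comp K.subtype) ⟨x, hx⟩ ⟨y, hy⟩ hxq hyq fun h => hxy (congrArg Subtype.val h.eq)
    refine hc1 (Subtype.ext (hcomm1 c ?_ hcq))
    have : (c : G) ∈ (commutator K).map K.subtype := ⟨c, hc, rfl⟩
    rw [commutator_def, Subgroup.map_commutator] at this
    refine Subgroup.commutator_mono ?_ le_top this
    exact Subgroup.map_subtype_le _
  have hKab : ∀ x ∈ K, ∀ y ∈ K, x * y = y * x := by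
    have : IsMulCommutative (Subgroup.closure (Group.conjugatesOfSet {a})) :=
      Subgroup.isMulCommutative_closure fun x hx y hy =>
        hquad x (hconj x hx).1 y (hconj y hy).1 (hconj x hx).2 (hconj y hy).2
    intro x hx y hy
    rw [← hcl, Subgroup.normalClosure] at hx hy
    exact setLike_mul_comm hx hy
  refine ⟨K, hN, ⟨a, haK, ha1, haq⟩, hKab, ?_, ?_⟩
  · intro x hx
    have hx' := hx
    rw [← hcl] at hx'
    induction hx' using Subgroup.closure_induction with
    | mem x h => exact (hconj x h).2.pow_eq_one hR hφ
    | one => exact one_pow p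
    | mul x y h h' ihx ihy =>
      have h1 : x ∈ K := hcl ▸ h
      have h2 : y ∈ K := hcl ▸ h'
      rw [(show Commute x y from hKab x h1 y h2).mul_pow, ihx h1, ihy h2, one_mul]
    | inv x h ih => rw [inv_pow, ih (hcl ▸ h), inv_one]
  · intro g hg w hw
    rw [← hcl] at hw
    induction hw using Subgroup.closure_induction with
    | mem x h =>
      obtain ⟨hxK, hxq⟩ := hconj x h
      have hmem : ⁅x, g⁆ ∈ ⁅K, (⊤ : Subgroup G)⁆ :=
        Subgroup.commutator_mem_commutator hxK (Subgroup.mem_top g)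
      have hmemK : ⁅x, g⁆ ∈ K := Subgroup.commutator_le_left K ⊤ hmem
      have hq : IsQuadratic φ ⁅x, g⁆⁻¹ := by
        refine hxq.of_conj_eq_mul h2 (b := g) ?_ ?_ (hg x hxK).inv_right
        · have hxc : x * ⁅x, g⁆⁻¹ = ⁅x, g⁆⁻¹ * x := hKab _ hxK _ (inv_mem hmemK)
          rw [hxc, commutatorElement_def]
          group
        · exact hKab _ hxK _ (inv_mem hmemK)
      have := hcomm1 _ (inv_mem hmem) hq
      exact (commutatorElement_eq_one_iff_commute.mp (inv_eq_one.mp this)).symm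
    | one => exact Commute.one_right g
    | mul x y _ _ hx hy => exact hx.mul_right hy
    | inv x _ hx => exact hx.inv_right

end MinimalNormal

section Thompson

variable {G : Type} [Group G] {p : ℕ}

open scoped commutatorElement IsMulCommutative

/-- The conjugation action of `G` on an abelian normal subgroup, written additively. -/
def conjEnd (K : Subgroup G) [K.Normal] [IsMulCommutative K] :
    G →* AddMonoid.End (Additive K) where
  toFun g := MonoidHom.toAdditive (MulAut.conjNormal g : MulAut K).toMonoidHom
  map_one' := by rw [map_one]; rfl
  map_mul' g h := by rw [map_mul]; rfl

theorem coe_conjEnd_apply (K : Subgroup G) [K.Normal] [IsMulCommutative K] (g : G)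
    (w : Additive K) : ((conjEnd K g w).toMul : G) = g * w.toMul * g⁻¹ := rfl

theorem conjEnd_apply_eq_self_iff (K : Subgroup G) [K.Normal] [IsMulCommutative K] (g : G)
    (w : Additive K) : conjEnd K g w = w ↔ Commute g w.toMul := by
  rw [commute_iff_eq, ← mul_inv_eq_iff_eq_mul, ← coe_conjEnd_apply]
  exact ⟨fun h => by rw [h], fun h => Additive.toMul.injective (Subtype.ext h)⟩

theorem conjEnd_eq_one_iff (K : Subgroup G) [K.Normal] [IsMulCommutative K] (g : G) :
    conjEnd K g = 1 ↔ ∀ w ∈ K, Commute g w := by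
  constructor
  · intro h w hw
    exact (conjEnd_apply_eq_self_iff K g (Additive.ofMul ⟨w, hw⟩)).mp (by rw [h]; rfl)
  · intro h
    ext1 w
    exact (conjEnd_apply_eq_self_iff K g w).mpr (h _ w.toMul.2)

theorem IsElemAbelian.sup_normal {A K : Subgroup G} [K.Normal] (hA : IsElemAbelian p A)
    (hK : IsElemAbelian p K) (hAK : ∀ a ∈ A, ∀ w ∈ K, Commute a w) : IsElemAbelian p (A ⊔ K) := by
  constructor
  · intro x hx y hy
    obtain ⟨a, ha, w, hw, rfl⟩ := Subgroup.mem_sup_of_normal_right.mp hx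
    obtain ⟨b, hb, u, hu, rfl⟩ := Subgroup.mem_sup_of_normal_right.mp hy
    have hab : Commute a b := hA.1 a ha b hb
    have hwu : Commute w u := hK.1 w hw u hu
    exact ((hab.mul_right (hAK a ha u hu)).mul_left ((hAK b hb w hw).symm.mul_right hwu)).eq
  · intro x hx
    obtain ⟨a, ha, w, hw, rfl⟩ := Subgroup.mem_sup_of_normal_right.mp hx
    rw [(hAK a ha w hw).mul_pow, hA.2 a ha, hK.2 w hw, one_mul]

theorem card_sup_mul_card_inf (C K : Subgroup G) [K.Normal] :
    Nat.card (C ⊔ K : Subgroup G) * Nat.card (C ⊓ K : Subgroup G) = Nat.card K * Nat.card C := by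
  have h1 : Nat.card K * K.relIndex C = Nat.card (C ⊔ K : Subgroup G) := by
    simpa using Subgroup.relIndex_mul_relIndex ⊥ K (C ⊔ K) bot_le le_sup_right
  have h2 : Nat.card (C ⊓ K : Subgroup G) * K.relIndex C = Nat.card C := by
    have h := Subgroup.relIndex_mul_relIndex ⊥ (C ⊓ K) C bot_le inf_le_left
    rwa [Subgroup.relIndex_bot_left, Subgroup.relIndex_bot_left, Subgroup.inf_relIndex_left] at h
  rw [← h1, ← h2]
  ring

/-- An elementary abelian normal subgroup on which no element acts quadratically and nontrivially
is contained in every elementary abelian subgroup of maximum order. -/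
theorem le_of_isElemAbelian_of_card_max [Finite G] [Fact p.Prime] (hG : IsPGroup p G)
    {K : Subgroup G} [K.Normal] (hK : IsElemAbelian p K)
    (hquad : ∀ g : G, (∀ w ∈ K, Commute g ⁅w, g⁆) → ∀ w ∈ K, Commute g w)
    {A : Subgroup G} (hA : IsElemAbelian p A)
    (hmax : ∀ F : Subgroup G, IsElemAbelian p F → Nat.card F ≤ Nat.card A) :
    (∀ a ∈ A, ∀ w ∈ K, Commute a w) ∧ K ≤ A := by
  have : IsMulCommutative K := .of_setLike_mul_comm fun x hx y hy => hK.1 x hx y hy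
  have hAK : ∀ a ∈ A, ∀ w ∈ K, Commute a w := by
    by_contra! hne
    obtain ⟨a, ha, w, hw, haw⟩ := hne
    have hC : IsElemAbelian p (A ⊓ (conjEnd K).ker) :=
      ⟨fun x hx y hy => hA.1 x hx.1 y hy.1, fun x hx => hA.2 x hx.1⟩
    have hsup := hmax _ (hC.sup_normal hK fun x hx => (conjEnd_eq_one_iff K x).mp hx.2)
    have hinf : Nat.card (A ⊓ (conjEnd K).ker ⊓ K : Subgroup G) ≤
        Nat.card (fixedVectors (conjEnd K) A) := by
      refine Nat.card_le_card_of_injective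
        (fun x => ⟨Additive.ofMul ⟨x, x.2.2⟩, fun b hb => ?_⟩) ?_
      · exact (conjEnd_apply_eq_self_iff K b _).mpr (hA.1 b hb x x.2.1.1)
      · intro x y hxy
        have := congrArg (fun z : fixedVectors (conjEnd K) A => ((z : Additive K).toMul : G)) hxy
        exact Subtype.ext this
    have hcard : Nat.card (Additive K) * Nat.card (A ⊓ (conjEnd K).ker : Subgroup G) ≤
        Nat.card A * Nat.card (fixedVectors (conjEnd K) A) := by
      change Nat.card K * _ ≤ _
      rw [← card_sup_mul_card_inf]
      gcongr
    obtain ⟨x, hx, hx1, hxq⟩ := exists_quadratic_of_offender (conjEnd K) A hG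
      (fun w => Additive.toMul.injective (Subtype.ext (hK.2 _ w.toMul.2))) hA.1
      ⟨a, ha, fun h => haw ((conjEnd_eq_one_iff K a).mp h w hw)⟩ hcard
    refine hx1 ((conjEnd_eq_one_iff K x).mpr (hquad x fun u hu => ?_))
    set w : Additive K := Additive.ofMul (⟨u, hu⟩ : K)
    have h : ((conjEnd K x - 1) * (conjEnd K x - 1)) w = 0 := by
      rw [← sq, hxq]; rfl
    have h' : conjEnd K x (conjEnd K x w - w) = conjEnd K x w - w := sub_eq_zero.mp h
    have h'' := (conjEnd_apply_eq_self_iff K x _).mp h'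
    have hval : ((conjEnd K x w - w).toMul : G) = ⁅u, x⁆⁻¹ := by
      rw [toMul_sub, Subgroup.coe_div, coe_conjEnd_apply, commutatorElement_inv,
        commutatorElement_def, div_eq_mul_inv]
      rfl
    rw [hval] at h''
    exact (Commute.inv_right_iff).mp h''
  refine ⟨hAK, ?_⟩
  have hle := hmax _ (hA.sup_normal hK hAK)
  exact le_sup_right.trans (Subgroup.eq_of_le_of_card_ge le_sup_left hle).ge

end Thompson

theorem oliver_thmB_module_form
    (p k : ℕ) [Fact p.Prime] (hp : 5 ≤ p) (hk3 : 3 ≤ k) (hkp : k ≤ p)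
    (V : Type) [AddCommGroup V] [Module (ZMod p) V] [Finite V]
    (G : Type) [Group G] [Finite G] (hGp : IsPGroup p G)
    (ρ : G →* (V ≃ₗ[ZMod p] V)) (hfaithful : Function.Injective ρ)
    -- `V` is a PS-module of degree `k` for `G`
    (hPS : ∀ z ∈ Subgroup.center G, z ≠ 1 → z ^ p = 1 →
      k ≤ (minpoly (ZMod p) (ρ z : Module.End (ZMod p) V)).natDegree)
    -- `V` is an F-module for `G`
    (hF : ∃ E : Subgroup G, E ≠ ⊥ ∧ IsElemAbelian p E ∧
      Nat.card V ≤ Nat.card E * Nat.card {v : V | ∀ g ∈ E, ρ g v = v}) :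
    -- the Baumann subgroup of `G` is proper
    (Baumann p : Subgroup G) ≠ ⊤ := by
  have hpp : p.Prime := Fact.out
  let φ : G →* Module.End (ZMod p) V :=
    LinearEquiv.automorphismGroup.toLinearMapMonoidHom.comp ρ
  have hφ : Function.Injective φ := fun a b h =>
    hfaithful (LinearEquiv.toLinearMap_injective h)
  let ψ : G →* AddMonoid.End V :=
    { toFun := fun g => (φ g).toAddMonoidHom
      map_one' := by rw [map_one]; rfl
      map_mul' := fun a b => by rw [map_mul]; rfl }
  have hpV : ∀ v : V, p • v = 0 := fun v => by
    rw [← Nat.cast_smul_eq_nsmul (ZMod p), CharP.cast_eq_zero, zero_smul]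
  have hR : (p : Module.End (ZMod p) V) = 0 := by
    ext v; simpa using hpV v
  have h2 : ∀ r : Module.End (ZMod p) V, 2 * r = 0 → r = 0 := by
    intro r hr
    have h20 : (2 : ZMod p) ≠ 0 := by
      have := (ZMod.natCast_eq_zero_iff 2 p).not.mpr fun h => by
        have := Nat.le_of_dvd two_pos h; omega
      exact_mod_cast this
    have hr' : (2 : ZMod p) • r = 0 := by rw [two_smul, ← two_mul, hr]
    exact (smul_eq_zero.mp hr').resolve_left h20
  have hψ : ∀ g, ψ g = 1 → g = 1 := fun g hg => by
    apply hφ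
    rw [map_one]
    ext v
    exact DFunLike.congr_fun hg v
  have hex : ∃ a : G, a ≠ 1 ∧ IsQuadratic φ a := by
    obtain ⟨E, hE1, hEab, hEcard⟩ := hF
    obtain ⟨a, ha, ha1⟩ := (Subgroup.ne_bot_iff_exists_ne_one).mp hE1 |>.elim
      fun a h => (⟨a.1, a.2, fun h' => h (Subtype.ext h')⟩ : ∃ a ∈ E, a ≠ 1)
    have hker : E ⊓ ψ.ker = ⊥ := (Subgroup.eq_bot_iff_forall _).mpr fun x hx => hψ x hx.2
    obtain ⟨x, -, hx1, hxq⟩ := exists_quadratic_of_offender ψ E hGp hpV hEab.1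
      ⟨a, ha, fun h => ha1 (hψ a h)⟩ (by rw [hker, Subgroup.card_bot, mul_one]; exact hEcard)
    refine ⟨x, fun h => hx1 (h ▸ map_one ψ), ?_⟩
    ext v
    exact DFunLike.congr_fun hxq v
  obtain ⟨K, hKn, ⟨a, haK, ha1, haq⟩, hKab, hKp, hKq⟩ :=
    exists_normal_generated_by_quadratic hGp hR h2 hφ hex
  intro hB
  have hA := fun (A : Subgroup G) (h : IsElemAbelian p A ∧
      ∀ F : Subgroup G, IsElemAbelian p F → Nat.card F ≤ Nat.card A) =>
    le_of_isElemAbelian_of_card_max (K := K) hGp ⟨hKab, hKp⟩ hKq h.1 h.2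
  obtain ⟨A, hAmem, hAmax⟩ := Set.exists_max_image {A : Subgroup G | IsElemAbelian p A}
    (fun A => Nat.card A) (Set.toFinite _) ⟨K, (⟨hKab, hKp⟩ : IsElemAbelian p K)⟩
  have haJ : a ∈ ThompsonJe (G := G) p :=
    (le_sSup (show A ∈ {E : Subgroup G | IsElemAbelian p E ∧
      ∀ F : Subgroup G, IsElemAbelian p F → Nat.card F ≤ Nat.card E} from ⟨hAmem, hAmax⟩)) ((hA A ⟨hAmem, hAmax⟩).2 haK)
  have haC : ThompsonJe p ≤ Subgroup.centralizer {a} := by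
    refine sSup_le fun A hAm b hb => ?_
    rw [Subgroup.mem_centralizer_singleton_iff]
    exact ((hA A hAm).1 b hb a haK).eq
  have hap : a ^ p = 1 := hKp a haK
  have haZ : a ∈ Omega1Center p (ThompsonJe (G := G) p) := by
    refine Subgroup.subset_closure ⟨⟨haJ, ?_⟩, hap⟩
    exact fun b hb => Subgroup.mem_centralizer_singleton_iff.mp (haC hb)
  have hacenter : a ∈ Subgroup.center G := by
    rw [Subgroup.mem_center_iff]
    intro g
    have hg : g ∈ Baumann (G := G) p := hB ▸ Subgroup.mem_top g
    exact (hg a haZ).symm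
  have hdeg := hPS a hacenter ha1 hap
  have hmin : minpoly (ZMod p) (φ a) ∣ (Polynomial.X - 1) ^ 2 :=
    minpoly.dvd _ _ (by simpa [IsQuadratic] using haq)
  have hmonic : ((Polynomial.X - 1 : Polynomial (ZMod p)) ^ 2).Monic :=
    (Polynomial.monic_X_sub_C (1 : ZMod p)).pow 2
  have hle := Polynomial.natDegree_le_of_dvd hmin hmonic.ne_zero
  have hnat : ((Polynomial.X - 1 : Polynomial (ZMod p)) ^ 2).natDegree = 2 := by
    rw [Polynomial.natDegree_pow, ← Polynomial.C_1, Polynomial.natDegree_X_sub_C]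
  have hdeg' : k ≤ (minpoly (ZMod p) (φ a)).natDegree := hdeg
  omega
end

section
/- Suppose p ≥ 5 is a prime. Let V be a finite elementary abelian p-group which is an F-module for the finite p-group G. Then there exists an offender E ≤ G which acts quadratically on V and which is normal in its normal closure ⟨E^G⟩ in G (i.e., E is 2-subnormal in G). -/
section QuadraticOffender

open PowerSeries Module

section InitialForms

variable {K R : Type*} [Field K] [Ring R] [Algebra K R]

/-- The lowest coefficients of the power series `a * Y * b`, where `Y` has coefficients in `L`. -/
def initialForms (a b : R⟦X⟧) (L : Submodule K R) : Submodule K R where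
  carrier := {r | ∃ (n : ℕ) (Y g : R⟦X⟧),
    (∀ i, coeff i Y ∈ L) ∧ a * Y * b = X ^ n * g ∧ constantCoeff g = r}
  zero_mem' := ⟨0, 0, 0, by simp, by simp, by simp⟩
  add_mem' := by
    rintro _ _ ⟨n, Y, g, hY, hg, rfl⟩ ⟨m, Z, h, hZ, hh, rfl⟩
    refine ⟨n + m, X ^ m * Y + X ^ n * Z, g + h, fun i => ?_, ?_, map_add _ _ _⟩
    · simp only [map_add, coeff_X_pow_mul']
      refine L.add_mem ?_ ?_ <;> split_ifs <;> simp [hY, hZ]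
    · have key (k : ℕ) (W : R⟦X⟧) : a * (X ^ k * W) * b = X ^ k * (a * W * b) := by
        rw [← mul_assoc a, ← (X_pow_mul : X ^ k * a = a * X ^ k)]; simp only [mul_assoc]
      rw [mul_add, add_mul, key, key, hg, hh, ← mul_assoc, ← mul_assoc, ← pow_add, ← pow_add,
        add_comm m n, ← mul_add]
  smul_mem' := by
    rintro k _ ⟨n, Y, g, hY, hg, rfl⟩
    refine ⟨n, k • Y, k • g, fun i => L.smul_mem k (hY i), ?_, rfl⟩
    rw [mul_smul_comm, smul_mul_assoc, hg, mul_smul_comm]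

theorem mul_eq_zero_of_coeff_mem {L N : Submodule K R} (hLN : ∀ x ∈ L, ∀ y ∈ N, x * y = 0)
    {Y Z : R⟦X⟧} (hY : ∀ i, coeff i Y ∈ L) (hZ : ∀ i, coeff i Z ∈ N) : Y * Z = 0 := by
  ext i
  rw [coeff_mul, map_zero]
  exact Finset.sum_eq_zero fun q _ => hLN _ (hY _) _ (hZ _)

theorem mul_eq_zero_of_mem_initialForms {a b c d : R⟦X⟧} {k : ℕ} (hbc : b * c = X ^ k)
    {L N : Submodule K R} (hLN : ∀ x ∈ L, ∀ y ∈ N, x * y = 0) {r s : R}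
    (hr : r ∈ initialForms a b L) (hs : s ∈ initialForms c d N) : r * s = 0 := by
  obtain ⟨n, Y, g, hY, hg, rfl⟩ := hr
  obtain ⟨m, Z, h, hZ, hh, rfl⟩ := hs
  have h1 : X ^ (n + m) * (g * h) = (0 : R⟦X⟧) := by
    calc X ^ (n + m) * (g * h) = (X ^ n * g) * (X ^ m * h) := by
          rw [pow_add, mul_assoc, ← mul_assoc (X ^ m) g, X_pow_mul (φ := g)]
          simp only [mul_assoc]
      _ = a * (Y * (b * c)) * (Z * d) := by rw [← hg, ← hh]; simp only [mul_assoc]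
      _ = a * (X ^ k * (Y * Z)) * d := by
          rw [hbc, ← (X_pow_mul : X ^ k * Y = _)]; simp only [mul_assoc]
      _ = 0 := by rw [mul_eq_zero_of_coeff_mem hLN hY hZ]; simp
  have h2 : g * h = 0 := X_pow_mul_cancel (k := n + m) (by rw [h1, mul_zero])
  rw [← map_mul, h2, map_zero]

theorem coeff_eq_zero_of_leftInverse [FiniteDimensional K R] {a b : R⟦X⟧} {L : Submodule K R}
    {π : R →ₗ[K] initialForms a b L} (hπ : ∀ r : initialForms a b L, π r = r)
    {Y : R⟦X⟧} (hY : ∀ i, coeff i Y ∈ L) {N : ℕ}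
    (h0 : ∀ i < N, π (coeff i (a * Y * b)) = 0) (i : ℕ) (hi : i < N) :
    coeff i (a * Y * b) = 0 := by
  induction i using Nat.strong_induction_on with
  | _ i ih =>
    obtain ⟨g, hg⟩ := X_pow_dvd_iff.2 fun m hm => ih m hm (hm.trans hi)
    have h1 : coeff i (a * Y * b) = constantCoeff g := by
      rw [hg, coeff_X_pow_mul']; simp
    have h2 := hπ ⟨coeff i (a * Y * b), i, Y, g, hY, hg, h1.symm⟩
    rw [h0 i hi] at h2
    exact (congrArg Subtype.val h2).symm

theorem finrank_le_finrank_initialForms [FiniteDimensional K R] {a b a' b' : R⟦X⟧} {k l : ℕ}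
    (ha : a' * a = X ^ k) (hb : b * b' = X ^ l) (L : Submodule K R) :
    finrank K L ≤ finrank K (initialForms a b L) := by
  set S := initialForms a b L with hS
  obtain ⟨π, hπ⟩ := S.subtype.exists_leftInverse_of_injective (by simp)
  have hπ' (r : S) : π r = r := LinearMap.congr_fun hπ r
  have key (n : ℕ) : n * finrank K L ≤ (n + (k + l)) * finrank K S := by
    let σ (y : Fin n → L) : R⟦X⟧ := PowerSeries.mk fun i => if h : i < n then (y ⟨i, h⟩ : R) else 0
    have σadd (y z) : σ (y + z) = σ y + σ z := by
      ext i; simp only [σ, coeff_mk, map_add]; split_ifs <;> simp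
    have σsmul (c : K) (y) : σ (c • y) = c • σ y := by
      ext i
      change coeff i (σ (c • y)) = c • coeff i (σ y)
      simp only [σ, coeff_mk]; split_ifs <;> simp
    have σmem (y i) : coeff i (σ y) ∈ L := by
      simp only [σ, coeff_mk]; split_ifs <;> simp
    let T : (Fin n → L) →ₗ[K] (Fin (n + (k + l)) → S) :=
      { toFun := fun y i => π (coeff i (a * σ y * b))
        map_add' := fun y z => by
          ext i; simp [σadd, mul_add, add_mul]
        map_smul' := fun c y => by
          funext i
          rw [σsmul, mul_smul_comm, smul_mul_assoc]
          exact π.map_smul c _ }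
    have hT : Function.Injective T := by
      rw [injective_iff_map_eq_zero]
      intro y hy
      have h1 := coeff_eq_zero_of_leftInverse hπ' (σmem y) (N := n + (k + l))
        fun i hi => congrFun hy ⟨i, hi⟩
      obtain ⟨g, hg⟩ := X_pow_dvd_iff.2 h1
      have h2 : X ^ (k + l) * σ y = X ^ (k + l) * (X ^ n * (a' * g * b')) := by
        calc X ^ (k + l) * σ y = X ^ k * (X ^ l * σ y) := by rw [pow_add, mul_assoc]
          _ = (a' * a) * (σ y * (b * b')) := by rw [ha, hb, X_pow_mul (φ := σ y)]
          _ = a' * (a * σ y * b) * b' := by simp only [mul_assoc]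
          _ = _ := by
            rw [hg, ← mul_assoc a', ← (X_pow_mul : X ^ _ * a' = _), add_comm n, pow_add]
            simp only [mul_assoc]
      have h3 := X_pow_mul_cancel h2
      funext i
      have h4 := congrArg (coeff (i : ℕ)) h3
      rw [coeff_X_pow_mul', if_neg (by simp)] at h4
      simpa [σ] using h4
    simpa [Module.finrank_pi_fintype] using LinearMap.finrank_le_finrank_of_injective hT
  by_contra! h
  have h1 := key ((k + l) * finrank K S + 1)
  have h2 := Nat.mul_le_mul_left ((k + l) * finrank K S + 1) (Nat.succ_le_of_lt h)
  grind

end InitialForms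

section EulerOperator

variable {R : Type*} [Ring R]

/-- The operator `X * d/dX` on power series. -/
noncomputable def eulerOperator : R⟦X⟧ →+ R⟦X⟧ where
  toFun f := PowerSeries.mk fun i => i • coeff i f
  map_zero' := by ext; simp
  map_add' f g := by ext; simp

theorem coeff_eulerOperator (i : ℕ) (f : R⟦X⟧) :
    coeff i (eulerOperator f) = i • coeff i f := by
  simp [eulerOperator]

theorem eulerOperator_X_mul (f : R⟦X⟧) :
    eulerOperator (X * f) = X * eulerOperator f + X * f := by
  ext i
  cases i with
  | zero => simp [coeff_eulerOperator]
  | succ i =>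
    simp only [coeff_eulerOperator, map_add, coeff_succ_X_mul, succ_nsmul]

theorem eulerOperator_X_pow_mul (n : ℕ) (f : R⟦X⟧) :
    eulerOperator (X ^ n * f) = X ^ n * (eulerOperator f + n • f) := by
  induction n with
  | zero => simp
  | succ n ih =>
    rw [pow_succ', mul_assoc, eulerOperator_X_mul, ih, succ_nsmul]
    simp only [mul_add, mul_assoc]
    abel

theorem eulerOperator_C_mul (a : R) (f : R⟦X⟧) :
    eulerOperator (C a * f) = C a * eulerOperator f := by
  ext i; simp only [coeff_eulerOperator, coeff_C_mul, mul_smul_comm]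

theorem eulerOperator_mul_C (a : R) (f : R⟦X⟧) :
    eulerOperator (f * C a) = eulerOperator f * C a := by
  ext i; simp only [coeff_eulerOperator, coeff_mul_C, smul_mul_assoc]

end EulerOperator

section Conjugation

variable {K R : Type*} [Field K] [Ring R] [Algebra K R] {x : R}

theorem add_mul_sub_eq_X_sq (hx : x * x = 0) :
    ((X : R⟦X⟧) + C x) * (X - C x) = X ^ 2 := by
  have h : (C x : R⟦X⟧) * C x = 0 := by rw [← map_mul, hx, map_zero]
  rw [add_mul, mul_sub, mul_sub, h, X_mul (φ := C x)]
  noncomm_ring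

theorem sub_mul_add_eq_X_sq (hx : x * x = 0) :
    ((X : R⟦X⟧) - C x) * (X + C x) = X ^ 2 := by
  have h : (C x : R⟦X⟧) * C x = 0 := by rw [← map_mul, hx, map_zero]
  rw [sub_mul, mul_add, mul_add, h, X_mul (φ := C x)]
  noncomm_ring

theorem add_mul_mul_sub (x : R) (Y : R⟦X⟧) :
    ((X : R⟦X⟧) + C x) * Y * (X - C x) =
      X * (X * Y) + X * (C x * Y - Y * C x) - C x * Y * C x := by
  have h1 : Y * X = X * Y := X_mul.symm
  have h2 : C x * (X * Y) = X * (C x * Y) := by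
    rw [← mul_assoc, ← X_mul, mul_assoc]
  simp only [add_mul, mul_sub, mul_assoc, h1, h2]
  abel

/-- The limit of the conjugates of `L` by `1 + t • x` as `t` tends to infinity,
where `x * x = 0`. -/
noncomputable def conjLimit (x : R) (L : Submodule K R) : Submodule K R :=
  initialForms (X + C x) (X - C x) L

theorem exists_of_mem_conjLimit {L : Submodule K R} {r : R} (hr : r ∈ conjLimit x L) :
    ∃ a ∈ L, ∃ b ∈ L, ∃ c ∈ L, r = a + (x * b - b * x) - x * c * x := by
  obtain ⟨n, Y, g, hY, hg, rfl⟩ := hr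
  have h : coeff n ((X + C x) * Y * (X - C x)) = constantCoeff g := by
    rw [hg, coeff_X_pow_mul']; simp
  rw [add_mul_mul_sub] at h
  match n with
  | 0 => exact ⟨0, L.zero_mem, 0, L.zero_mem, _, hY 0, by rw [← h]; simp⟩
  | 1 => exact ⟨0, L.zero_mem, _, hY 0, _, hY 1, by
      have h1 (Z : R⟦X⟧) : coeff 1 (X * Z) = coeff 0 Z := coeff_succ_X_mul 0 Z
      rw [← h]; simp [h1]⟩
  | n + 2 => exact ⟨_, hY n, _, hY (n + 1), _, hY (n + 2), by
      rw [← h]; simp [coeff_succ_X_mul]⟩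

theorem commutator_mem_conjLimit (hx : x * x = 0) {L : Submodule K R} {r : R}
    (hr : r ∈ conjLimit x L) : x * r - r * x ∈ conjLimit x L := by
  obtain ⟨n, Y, g, hY, hg, rfl⟩ := hr
  refine ⟨n, X * (eulerOperator Y + 2 • Y), C x * g - g * C x + X * (eulerOperator g + n • g),
    fun i => ?_, ?_, by simp⟩
  · cases i with
    | zero => simp
    | succ i =>
      rw [coeff_succ_X_mul, map_add, coeff_eulerOperator, map_nsmul]
      exact L.add_mem (L.smul_of_tower_mem _ (hY i)) (L.smul_of_tower_mem _ (hY i))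
  · have h1 : (C x : R⟦X⟧) * C x = 0 := by rw [← map_mul, hx, map_zero]
    have h1' (Z : R⟦X⟧) : C x * (C x * Z) = 0 := by rw [← mul_assoc, h1, zero_mul]
    have h2 (Z : R⟦X⟧) : C x * (X * Z) = X * (C x * Z) := by
      rw [← mul_assoc, ← X_mul, mul_assoc]
    have h4 : X ^ n * (C x * g - g * C x + X * (eulerOperator g + n • g)) =
        C x * (X ^ n * g) - (X ^ n * g) * C x + X * eulerOperator (X ^ n * g) := by
      rw [eulerOperator_X_pow_mul, mul_add, mul_sub, ← mul_assoc (C x), ← X_pow_mul,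
        ← mul_assoc X, X_mul (φ := X ^ n)]
      simp only [mul_assoc]
    rw [h4, ← hg, add_mul_mul_sub, add_mul_mul_sub]
    simp only [map_add, map_sub, eulerOperator_X_mul, eulerOperator_C_mul,
      eulerOperator_mul_C, mul_add, mul_sub, add_mul, sub_mul, mul_assoc, h1, h1', h2,
      two_nsmul, mul_zero]
    abel

theorem mul_mul_mem_conjLimit (h2 : (2 : K) ≠ 0) (hx : x * x = 0) {L : Submodule K R} {r : R}
    (hr : r ∈ conjLimit x L) : x * r * x ∈ conjLimit x L := by
  have h := commutator_mem_conjLimit hx (commutator_mem_conjLimit hx hr)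
  have h' : x * r * x = (-(2 : K)⁻¹) • (x * (x * r - r * x) - (x * r - r * x) * x) := by
    have h3 : x * (x * r - r * x) - (x * r - r * x) * x = (-2 : K) • (x * r * x) := by
      rw [mul_sub, sub_mul, ← mul_assoc x x, hx, mul_assoc r x x, hx, neg_smul, two_smul]
      noncomm_ring
    rw [h3, smul_smul, neg_mul_neg, inv_mul_cancel₀ h2, one_smul]
  rw [h']
  exact Submodule.smul_mem _ _ h

theorem mem_of_forall_int_smul_add_mem (h2 : (2 : K) ≠ 0) (h3 : (3 : K) ≠ 0)
    {M : Type*} [AddCommGroup M] [Module K M] {L : Submodule K M} {c₀ c₁ c₂ c₃ c₄ : M}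
    (h : ∀ i : ℤ, c₀ + (i : K) • c₁ + (i : K) ^ 2 • c₂ + (i : K) ^ 3 • c₃ + (i : K) ^ 4 • c₄ ∈ L) :
    c₀ ∈ L ∧ c₁ ∈ L ∧ c₂ ∈ L ∧ c₃ ∈ L ∧ c₄ ∈ L := by
  have m0 := h 0
  have m1 := h 1
  have m2 := h (-1)
  have m3 := h 2
  have m4 := h (-2)
  push_cast at m0 m1 m2 m3 m4
  have h12 : (12 : K) ≠ 0 := by
    have : (12 : K) = 2 * 2 * 3 := by norm_num
    simp [this, h2, h3]
  have k0 : c₀ ∈ L := by simpa using m0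
  have k4 : c₄ ∈ L := by
    have := L.smul_mem (24 : K)⁻¹ (L.add_mem (L.sub_mem (L.add_mem m3 m4)
      (L.smul_mem (4 : K) (L.add_mem m1 m2))) (L.smul_mem (6 : K) m0))
    have h24 : (24 : K) ≠ 0 := by
      have : (24 : K) = 2 * 12 := by norm_num
      simp [this, h2, h12]
    convert this using 1
    match_scalars <;> field_simp <;> ring
  have k2 : c₂ ∈ L := by
    have := L.sub_mem (L.smul_mem (2 : K)⁻¹ (L.add_mem m1 m2)) (L.add_mem k0 k4)
    convert this using 1
    match_scalars <;> field_simp <;> ring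
  have k3 : c₃ ∈ L := by
    have := L.smul_mem (12 : K)⁻¹
      (L.sub_mem (L.sub_mem m3 m4) (L.smul_mem (2 : K) (L.sub_mem m1 m2)))
    convert this using 1
    match_scalars <;> field_simp <;> ring
  have k1 : c₁ ∈ L := by
    have := L.sub_mem (L.smul_mem (2 : K)⁻¹ (L.sub_mem m1 m2)) k3
    convert this using 1
    match_scalars <;> field_simp <;> ring
  exact ⟨k0, k1, k2, k3, k4⟩

theorem coeff_X_mul_mem {L : Submodule K R} {Y : R⟦X⟧} (hY : ∀ i, coeff i Y ∈ L) (i : ℕ) :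
    coeff i (X * Y) ∈ L := by
  cases i with
  | zero => simp
  | succ i => rw [coeff_succ_X_mul]; exact hY i

theorem mem_conjLimit_of_forall_int (h2 : (2 : K) ≠ 0) (h3 : (3 : K) ≠ 0) (hx : x * x = 0)
    {L : Submodule K R} {t : R}
    (ht : ∀ i : ℤ, ∀ y ∈ L, ∀ u, u = t - (i : K) • (x * t - t * x) - (i : K) ^ 2 • (x * t * x) →
      u * y - y * u ∈ L ∧ u * y * u ∈ L) {r : R} (hr : r ∈ conjLimit x L) :
    t * r - r * t ∈ conjLimit x L ∧ t * r * t ∈ conjLimit x L := by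
  obtain ⟨n, Y, g, hY, hg, rfl⟩ := hr
  set a := x * t - t * x with ha
  set b := x * t * x with hb
  have hlin (y) (hy : y ∈ L) : t * y - y * t ∈ L ∧ a * y - y * a ∈ L ∧ b * y - y * b ∈ L := by
    obtain ⟨k0, k1, k2, -, -⟩ := mem_of_forall_int_smul_add_mem h2 h3 (L := L)
      (c₀ := t * y - y * t) (c₁ := -(a * y - y * a)) (c₂ := -(b * y - y * b)) (c₃ := 0) (c₄ := 0)
      fun i => by
        convert (ht i y hy _ rfl).1 using 1
        simp only [sub_mul, mul_sub, smul_mul_assoc, mul_smul_comm]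
        module
    exact ⟨k0, neg_mem_iff.1 k1, neg_mem_iff.1 k2⟩
  have hquad (y) (hy : y ∈ L) : t * y * t ∈ L ∧ t * y * a + a * y * t ∈ L ∧
      a * y * a - t * y * b - b * y * t ∈ L ∧ a * y * b + b * y * a ∈ L ∧ b * y * b ∈ L := by
    obtain ⟨k0, k1, k2, k3, k4⟩ := mem_of_forall_int_smul_add_mem h2 h3 (L := L)
      (c₀ := t * y * t) (c₁ := -(t * y * a + a * y * t))
      (c₂ := a * y * a - t * y * b - b * y * t) (c₃ := a * y * b + b * y * a) (c₄ := b * y * b)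
      fun i => by
        convert (ht i y hy _ rfl).2 using 1
        simp only [sub_mul, mul_sub, smul_mul_assoc, mul_smul_comm]
        module
    exact ⟨k0, neg_mem_iff.1 k1, k2, k3, k4⟩
  have hX (c : R) (Z : R⟦X⟧) : C c * (X * Z) = X * (C c * Z) := by
    rw [← mul_assoc, ← X_mul, mul_assoc]
  have hYX (Z : R⟦X⟧) : Y * (X * Z) = X * (Y * Z) := by
    rw [← mul_assoc, ← X_mul, mul_assoc]
  have hX' (c : R) : C c * X = X * C c := X_mul.symm
  obtain ⟨τ, hτ⟩ : ∃ τ : R⟦X⟧, τ = (X - C x) * C t * (X + C x) := ⟨_, rfl⟩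
  have hτ' : τ = X * (X * C t) - X * C a - C b := by
    rw [hτ, ha, hb]
    simp only [map_sub, map_mul, mul_add, sub_mul, mul_sub, mul_assoc, hX, hX']
    abel
  have e1 : ((X : R⟦X⟧) + C x) * τ = X ^ 2 * (C t * (X + C x)) := by
    rw [hτ, ← mul_assoc, ← mul_assoc, add_mul_sub_eq_X_sq hx, mul_assoc]
  have e2 : τ * ((X : R⟦X⟧) - C x) = (X - C x) * C t * X ^ 2 := by
    rw [hτ, mul_assoc, add_mul_sub_eq_X_sq hx]
  have e3 (Z : R⟦X⟧) : Z * X ^ 2 = X ^ 2 * Z := X_pow_mul.symm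
  have e4 (Z : R⟦X⟧) : C t * (X ^ n * Z) = X ^ n * (C t * Z) := by
    rw [← mul_assoc, ← X_pow_mul, mul_assoc]
  constructor
  · refine ⟨n + 2, τ * Y - Y * τ, C t * g - g * C t, fun i => ?_, ?_, by simp⟩
    · have : τ * Y - Y * τ = X * (X * (C t * Y - Y * C t)) - X * (C a * Y - Y * C a)
          - (C b * Y - Y * C b) := by
        rw [hτ']
        have hYX' : Y * X = X * Y := X_mul.symm
        simp only [sub_mul, mul_sub, mul_assoc, hYX]
        abel
      rw [this, map_sub, map_sub]
      refine L.sub_mem (L.sub_mem (coeff_X_mul_mem (coeff_X_mul_mem fun j => ?_) i)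
        (coeff_X_mul_mem (fun j => ?_) i)) ?_ <;>
      simp only [map_sub, coeff_C_mul, coeff_mul_C, hlin _ (hY _)]
    · calc (X + C x) * (τ * Y - Y * τ) * (X - C x)
          = ((X + C x) * τ) * Y * (X - C x) - (X + C x) * Y * (τ * (X - C x)) := by
            simp only [mul_sub, sub_mul, mul_assoc]; abel
        _ = X ^ 2 * (C t * ((X + C x) * Y * (X - C x))) -
              (((X + C x) * Y * (X - C x)) * C t) * X ^ 2 := by
            rw [e1, e2]; simp only [mul_assoc]
        _ = _ := by
            rw [hg, e3, e4, show n + 2 = 2 + n by ring, pow_add]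
            simp only [mul_sub, mul_assoc]
  · refine ⟨n + 4, τ * Y * τ, C t * g * C t, fun i => ?_, ?_, by simp⟩
    · have : τ * Y * τ = X * (X * (X * (X * (C t * Y * C t)))) -
          X * (X * (X * (C t * Y * C a + C a * Y * C t))) +
          X * (X * (C a * Y * C a - C t * Y * C b - C b * Y * C t)) +
          X * (C a * Y * C b + C b * Y * C a) + C b * Y * C b := by
        rw [hτ']
        simp only [sub_mul, mul_sub, mul_add, mul_assoc, hYX, hX]
        abel
      rw [this]
      simp only [map_add, map_sub]
      refine L.add_mem (L.add_mem (L.add_mem (L.sub_mem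
        (coeff_X_mul_mem (coeff_X_mul_mem (coeff_X_mul_mem (coeff_X_mul_mem fun j => ?_))) i)
        (coeff_X_mul_mem (coeff_X_mul_mem (coeff_X_mul_mem fun j => ?_)) i))
        (coeff_X_mul_mem (coeff_X_mul_mem fun j => ?_) i))
        (coeff_X_mul_mem (fun j => ?_) i)) ?_ <;>
      simp only [map_sub, map_add, coeff_C_mul, coeff_mul_C, hquad _ (hY _)]
    · calc (X + C x) * (τ * Y * τ) * (X - C x)
          = ((X + C x) * τ) * Y * (τ * (X - C x)) := by simp only [mul_assoc]
        _ = X ^ 2 * ((C t * ((X + C x) * Y * (X - C x)) * C t) * X ^ 2) := by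
            rw [e1, e2]; simp only [mul_assoc]
        _ = _ := by
            rw [hg, e3, e4, show n + 4 = 2 + 2 + n by ring, pow_add, pow_add]
            simp only [mul_assoc]

end Conjugation

section Product

variable {K R : Type*} [Field K] [Ring R] [Algebra K R]

theorem one_add_add_add_eq_mul (h2 : (2 : K) ≠ 0) (h3 : (3 : K) ≠ 0) {a b c p q s u v : R}
    (haa : a * a = 0) (hbb : b * b = 0) (hcc : c * c = 0)
    (hp : a * b - b * a = p) (hq : a * c - c * a = q) (hs : b * c - c * b = s)
    (hu : c * p - p * c = u) (hv : b * q - q * b = v)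
    (hap : a * p = 0) (hbp : b * p = 0) (haq : a * q = 0) (hcq : c * q = 0)
    (hbs : b * s = 0) (hcs : c * s = 0)
    (hpq : p * q = 0) (hps : p * s = 0) (hqs : q * s = 0) (hpp : p * p = 0) (hqq : q * q = 0)
    (hss : s * s = 0) (hqp : q * p = 0) (hsp : s * p = 0) (hsq : s * q = 0)
    (hau : a * u = 0) (hbu : b * u = 0) (hcu : c * u = 0)
    (hav : a * v = 0) (hbv : b * v = 0) (hcv : c * v = 0)
    (huu : u * u = 0) (huv : u * v = 0) (hvu : v * u = 0) (hvv : v * v = 0)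
    (hw : (a + b + c) * (a + b + c) = 0) :
    1 + (a + b + c) = (1 + a) * (1 + b) * (1 + c) * ((1 + (-(2 : K)⁻¹) • p) *
      (1 + (-(2 : K)⁻¹) • q) * (1 + (-(2 : K)⁻¹) • s)) * (1 + (3 : K)⁻¹ • (u + v)) := by
  have e1 : a * b + a * c + b * c = (2 : K)⁻¹ • (p + q + s) := by
    have h : (2 : K) • (a * b + a * c + b * c) = p + q + s := by
      rw [← sub_eq_zero, ← hw, ← hp, ← hq, ← hs]
      simp only [add_mul, mul_add, haa, hbb, hcc]
      module
    rw [← h, smul_smul, inv_mul_cancel₀ h2, one_smul]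
  have haba : a * (b * a) = 0 := by
    have := hap; rw [← hp, mul_sub, ← mul_assoc, haa, zero_mul, zero_sub, neg_eq_zero] at this
    exact this
  have hbab : b * (a * b) = 0 := by
    have := hbp; rw [← hp, mul_sub, ← mul_assoc b b, hbb, zero_mul, sub_zero] at this
    exact this
  have haca : a * (c * a) = 0 := by
    have := haq; rw [← hq, mul_sub, ← mul_assoc, haa, zero_mul, zero_sub, neg_eq_zero] at this
    exact this
  have hcac : c * (a * c) = 0 := by
    have := hcq; rw [← hq, mul_sub, ← mul_assoc c c, hcc, zero_mul, sub_zero] at this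
    exact this
  have hbcb : b * (c * b) = 0 := by
    have := hbs; rw [← hs, mul_sub, ← mul_assoc, hbb, zero_mul, zero_sub, neg_eq_zero] at this
    exact this
  have hcbc : c * (b * c) = 0 := by
    have := hcs; rw [← hs, mul_sub, ← mul_assoc c c, hcc, zero_mul, sub_zero] at this
    exact this
  have haa' (z : R) : a * (a * z) = 0 := by rw [← mul_assoc, haa, zero_mul]
  have hbb' (z : R) : b * (b * z) = 0 := by rw [← mul_assoc, hbb, zero_mul]
  have hcc' (z : R) : c * (c * z) = 0 := by rw [← mul_assoc, hcc, zero_mul]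
  have e2 : a * (b * c) + a * (c * b) + b * (a * c) + b * (c * a) + c * (a * b) + c * (b * a)
      = 0 := by
    have h : (a + b + c) * ((a + b + c) * (a + b + c)) = 0 := by rw [hw, mul_zero]
    rw [← h]
    simp only [mul_add, add_mul, haa, hbb, hcc, haa', hbb', hcc', haba, hbab, haca, hcac, hbcb,
      hcbc, mul_zero]
    abel
  have e3 : (1 + (-(2 : K)⁻¹) • p) * (1 + (-(2 : K)⁻¹) • q) * (1 + (-(2 : K)⁻¹) • s) =
      1 - (2 : K)⁻¹ • (p + q + s) := by
    simp only [mul_add, add_mul, smul_mul_assoc, mul_smul_comm, hpq, hps, hqs, mul_one, one_mul,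
      smul_zero, zero_mul]
    module
  have e4 : (1 + a) * (1 + b) * (1 + c) =
      1 + (a + b + c) + (2 : K)⁻¹ • (p + q + s) + a * (b * c) := by
    rw [← e1]; noncomm_ring
  have e5 : a * (b * c) - (2 : K)⁻¹ • (c * p + b * q + a * s) = (-(3 : K)⁻¹) • (u + v) := by
    have h : (3 : K) • (a * (b * c) - (2 : K)⁻¹ • (c * p + b * q + a * s)) + (u + v) =
        (2 : K)⁻¹ • (a * (b * c) + a * (c * b) + b * (a * c) + b * (c * a) + c * (a * b) +
          c * (b * a)) := by
      rw [← hu, ← hv, ← hp, ← hq, ← hs]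
      simp only [mul_sub, sub_mul, mul_assoc]
      match_scalars <;> field_simp <;> ring
    rw [e2, smul_zero] at h
    rw [neg_smul, ← smul_neg, ← eq_neg_of_add_eq_zero_left h, smul_smul, inv_mul_cancel₀ h3,
      one_smul]
  have e6 : (a * (b * c)) * p = 0 := by
    have hcp : c * p = p * c + u := by rw [← hu]; abel
    rw [mul_assoc, mul_assoc, hcp, mul_add, ← mul_assoc b p, hbp, hbu]; simp
  have e7 : (1 + a) * (1 + b) * (1 + c) * (1 - (2 : K)⁻¹ • (p + q + s)) =
      1 + (a + b + c) + (-(3 : K)⁻¹) • (u + v) := by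
    rw [e4, ← e5]
    have e8 : (a * (b * c)) * q = 0 := by rw [mul_assoc, mul_assoc, hcq]; simp
    have e9 : (a * (b * c)) * s = 0 := by rw [mul_assoc, mul_assoc, hcs]; simp
    simp only [mul_sub, mul_add, add_mul, smul_mul_assoc, mul_smul_comm, e6, e8, e9, hap, hbp,
      haq, hcq, hbs, hcs, hpp, hpq, hps, hqp, hqq, hqs, hsp, hsq, hss, mul_one, one_mul]
    module
  rw [e3, e7]
  simp only [mul_add, add_mul, smul_mul_assoc, mul_smul_comm, hau, hbu, hcu, hav, hbv, hcv, huu,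
    huv, hvu, hvv, mul_one, one_mul]
  module

theorem one_add_mem_of_mul_self_eq_zero (h2 : (2 : K) ≠ 0) (h3 : (3 : K) ≠ 0)
    {H : Submonoid R} {L : ℕ → Submodule K R}
    (hLL : ∀ i, ∀ a ∈ L i, ∀ b ∈ L i, a * b = 0)
    (hL : ∀ i j, ∀ a ∈ L i, ∀ b ∈ L j, a * b - b * a ∈ L i)
    (hH : ∀ i, ∀ a ∈ L i, 1 + a ∈ H) {a b c : R} (ha : a ∈ L 0) (hb : b ∈ L 1) (hc : c ∈ L 2)
    (hw : (a + b + c) * (a + b + c) = 0) : 1 + (a + b + c) ∈ H := by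
  have hL' (i j) (a) (ha : a ∈ L i) (b) (hb : b ∈ L j) : a * b - b * a ∈ L j := by
    rw [← neg_sub]; exact neg_mem (hL _ _ _ hb _ ha)
  have p0 := hL _ _ a ha b hb
  have p1 := hL' _ _ a ha b hb
  have q0 := hL _ _ a ha c hc
  have q2 := hL' _ _ a ha c hc
  have s1 := hL _ _ b hb c hc
  have s2 := hL' _ _ b hb c hc
  have u0 := hL' _ _ c hc _ p0
  have u1 := hL' _ _ c hc _ p1
  have u2 := hL _ _ c hc _ p1
  have v0 := hL' _ _ b hb _ q0
  have v1 := hL _ _ b hb _ q0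
  have v2 := hL' _ _ b hb _ q2
  rw [one_add_add_add_eq_mul h2 h3 (hLL _ _ ha _ ha) (hLL _ _ hb _ hb) (hLL _ _ hc _ hc)
    rfl rfl rfl rfl rfl (hLL _ _ ha _ p0) (hLL _ _ hb _ p1) (hLL _ _ ha _ q0)
    (hLL _ _ hc _ q2) (hLL _ _ hb _ s1) (hLL _ _ hc _ s2) (hLL _ _ p0 _ q0) (hLL _ _ p1 _ s1)
    (hLL _ _ q2 _ s2) (hLL _ _ p0 _ p0) (hLL _ _ q0 _ q0) (hLL _ _ s1 _ s1) (hLL _ _ q0 _ p0)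
    (hLL _ _ s1 _ p1) (hLL _ _ s2 _ q2) (hLL _ _ ha _ u0) (hLL _ _ hb _ u1) (hLL _ _ hc _ u2)
    (hLL _ _ ha _ v0) (hLL _ _ hb _ v1) (hLL _ _ hc _ v2) (hLL _ _ u0 _ u0) (hLL _ _ u0 _ v0)
    (hLL _ _ v0 _ u0) (hLL _ _ v0 _ v0) hw]
  refine H.mul_mem (H.mul_mem (H.mul_mem (H.mul_mem (hH _ _ ha) (hH _ _ hb)) (hH _ _ hc))
    (H.mul_mem (H.mul_mem ?_ ?_) ?_)) ?_
  · exact hH 0 _ ((L 0).smul_mem _ p0)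
  · exact hH 0 _ ((L 0).smul_mem _ q0)
  · exact hH 1 _ ((L 1).smul_mem _ s1)
  · exact hH 0 _ ((L 0).smul_mem _ ((L 0).add_mem u0 v0))

end Product

section Representation

variable {K R G : Type*} [Field K] [Ring R] [Algebra K R] [Group G]

/-- The right annihilator of a subspace of an algebra. -/
def rightAnnihilator (L : Submodule K R) : Submodule K R where
  carrier := {z | ∀ t ∈ L, t * z = 0}
  zero_mem' := fun _ _ => mul_zero _
  add_mem' := fun ha hb t ht => by rw [mul_add, ha t ht, hb t ht, add_zero]
  smul_mem' := fun c z hz t ht => by rw [mul_smul_comm, hz t ht, smul_zero]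

/-- The elements of `G` which normalize the subspace `L` via conjugation. -/
def conjStabilizer (τ : G →* R) (L : Submodule K R) : Subgroup G where
  carrier := {g | ∀ y ∈ L, τ g * y * τ g⁻¹ ∈ L ∧ τ g⁻¹ * y * τ g ∈ L}
  one_mem' := fun y hy => by simpa using hy
  mul_mem' := fun {g h} hg hh y hy => by
    constructor
    · have := (hg _ (hh y hy).1).1
      simpa only [mul_inv_rev, map_mul, mul_assoc] using this
    · have := (hh _ (hg y hy).2).2
      simpa only [mul_inv_rev, map_mul, mul_assoc] using this
  inv_mem' := fun {g} hg y hy => by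
    rw [inv_inv]; exact (hg y hy).symm

/-- For `R` the endomorphism algebra of a space of dimension `m`, these are the subspaces
`{g - 1 | g ∈ E}` attached to quadratic offenders `E`. -/
structure IsOffenderSpace (τ : G →* R) (m : ℕ) (L : Submodule K R) : Prop where
  mul_eq_zero : ∀ a ∈ L, ∀ b ∈ L, a * b = 0
  exists_map_eq : ∀ t ∈ L, ∃ g, τ g = 1 + t
  ne_bot : L ≠ ⊥
  finrank_le : finrank K R ≤ m * finrank K L + finrank K (rightAnnihilator L)

variable {τ : G →* R} {m : ℕ} {L : Submodule K R} {x : R} {g : G}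

theorem map_inv_eq_one_sub (hg : τ g = 1 + x) (hx : x * x = 0) : τ g⁻¹ = 1 - x := by
  have h : τ g * (1 - x) = 1 := by
    rw [hg, mul_sub, add_mul 1 x x, hx]; simp
  calc τ g⁻¹ = τ g⁻¹ * (τ g * (1 - x)) := by rw [h, mul_one]
    _ = 1 - x := by rw [← mul_assoc, ← map_mul, inv_mul_cancel, map_one, one_mul]

theorem map_zpow_eq_one_add_smul (hg : τ g = 1 + x) (hx : x * x = 0) (i : ℤ) :
    τ (g ^ i) = 1 + (i : K) • x := by
  induction i with
  | zero => simp
  | succ n ih =>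
    rw [zpow_add_one, map_mul, ih, hg, add_mul, mul_add, mul_add, smul_mul_assoc,
      smul_mul_assoc, hx]
    push_cast
    simp only [mul_one, one_mul]
    module
  | pred n ih =>
    rw [zpow_sub_one, map_mul, ih, map_inv_eq_one_sub hg hx, add_mul, mul_sub, mul_sub,
      smul_mul_assoc, smul_mul_assoc, hx]
    push_cast
    simp only [mul_one, one_mul]
    module

theorem map_zpow_conj (hg : τ g = 1 + x) (hx : x * x = 0) (i : ℤ) (z : R) :
    τ (g ^ i) * z * τ (g ^ (-i)) =
      z + (i : K) • (x * z - z * x) - (i : K) ^ 2 • (x * z * x) := by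
  rw [map_zpow_eq_one_add_smul (K := K) hg hx, map_zpow_eq_one_add_smul (K := K) hg hx]
  simp only [add_mul, mul_add, mul_one, one_mul, smul_mul_assoc, mul_smul_comm]
  push_cast
  module

theorem mem_conjStabilizer_iff (h2 : (2 : K) ≠ 0) (hg : τ g = 1 + x) (hx : x * x = 0) :
    g ∈ conjStabilizer τ L ↔ ∀ y ∈ L, x * y - y * x ∈ L ∧ x * y * x ∈ L := by
  have e1 (y : R) : τ g * y * τ g⁻¹ = y + (x * y - y * x) - x * y * x := by
    rw [map_inv_eq_one_sub hg hx, hg]; noncomm_ring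
  have e2 (y : R) : τ g⁻¹ * y * τ g = y - (x * y - y * x) - x * y * x := by
    rw [map_inv_eq_one_sub hg hx, hg]; noncomm_ring
  refine ⟨fun h y hy => ?_, fun h y hy => ?_⟩
  · obtain ⟨h3, h4⟩ := h y hy
    rw [e1] at h3
    rw [e2] at h4
    constructor
    · convert L.smul_mem (2 : K)⁻¹ (L.sub_mem h3 h4) using 1
      match_scalars <;> field_simp <;> ring
    · convert L.sub_mem hy (L.smul_mem (2 : K)⁻¹ (L.add_mem h3 h4)) using 1
      match_scalars <;> field_simp <;> ring
  · rw [e1, e2]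
    obtain ⟨h3, h4⟩ := h y hy
    exact ⟨L.sub_mem (L.add_mem hy h3) h4, L.sub_mem (L.sub_mem hy h3) h4⟩

theorem sub_one_mul_self_conj {u : G} (hu : (τ u - 1) * (τ u - 1) = 0) (h : G) :
    (τ (h * u * h⁻¹) - 1) * (τ (h * u * h⁻¹) - 1) = 0 := by
  have h1 : τ h⁻¹ * τ h = 1 := by rw [← map_mul, inv_mul_cancel, map_one]
  have h1' : τ h * τ h⁻¹ = 1 := by rw [← map_mul, mul_inv_cancel, map_one]
  have h2 : τ (h * u * h⁻¹) - 1 = τ h * (τ u - 1) * τ h⁻¹ := by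
    rw [mul_sub, sub_mul, map_mul, map_mul, mul_one, h1']
  calc (τ (h * u * h⁻¹) - 1) * (τ (h * u * h⁻¹) - 1)
      = τ h * ((τ u - 1) * (τ h⁻¹ * τ h) * (τ u - 1)) * τ h⁻¹ := by
        rw [h2]; simp only [mul_assoc]
    _ = 0 := by rw [h1, mul_one, hu, mul_zero, zero_mul]

theorem IsOffenderSpace.mem_conjStabilizer (h2 : (2 : K) ≠ 0) (hL : IsOffenderSpace τ m L)
    {u : G} {t : R} (ht : t ∈ L) (hu : τ u = 1 + t) : u ∈ conjStabilizer τ L := by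
  rw [mem_conjStabilizer_iff h2 hu (hL.mul_eq_zero _ ht _ ht)]
  intro y hy
  rw [hL.mul_eq_zero _ ht _ hy, hL.mul_eq_zero _ hy _ ht]
  simp

theorem IsOffenderSpace.finrank_le_conjLimit [FiniteDimensional K R] (hL : IsOffenderSpace τ m L)
    (hx : x * x = 0) :
    finrank K R ≤ m * finrank K (conjLimit x L) + finrank K (rightAnnihilator (conjLimit x L)) := by
  have h1 : finrank K L ≤ finrank K (conjLimit x L) :=
    finrank_le_finrank_initialForms (sub_mul_add_eq_X_sq hx) (sub_mul_add_eq_X_sq hx) L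
  have h2 : finrank K (rightAnnihilator L) ≤
      finrank K (initialForms (X + C x) 1 (rightAnnihilator L)) :=
    finrank_le_finrank_initialForms (sub_mul_add_eq_X_sq hx)
      (show (1 : R⟦X⟧) * 1 = X ^ 0 by simp) _
  have h3 : initialForms (X + C x) 1 (rightAnnihilator L) ≤ rightAnnihilator (conjLimit x L) :=
    fun s hs r hr => mul_eq_zero_of_mem_initialForms (N := rightAnnihilator L)
      (sub_mul_add_eq_X_sq hx) (fun a ha _ hb => hb a ha) hr hs
  exact hL.finrank_le.trans
    (add_le_add (Nat.mul_le_mul_left m h1) (h2.trans (Submodule.finrank_mono h3)))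

/-- The conjugate of `L` by `g`. -/
def conjSubmodule (τ : G →* R) (L : Submodule K R) (g : G) : Submodule K R :=
  L.map (LinearMap.mulRight K (τ g⁻¹) ∘ₗ LinearMap.mulLeft K (τ g))

theorem mem_conjSubmodule {r : R} :
    r ∈ conjSubmodule τ L g ↔ ∃ y ∈ L, τ g * y * τ g⁻¹ = r := by
  simp [conjSubmodule]

theorem IsOffenderSpace.commutator_mem_conjSubmodule (h2 : (2 : K) ≠ 0)
    (hL : IsOffenderSpace τ m L)
    (hg : ∀ u ∈ conjStabilizer τ L, (τ u - 1) * (τ u - 1) = 0 →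
      ∀ i : ℤ, g ^ i * u * g ^ (-i) ∈ conjStabilizer τ L) (i j : ℤ) {a b : R}
    (ha : a ∈ conjSubmodule τ L (g ^ i)) (hb : b ∈ conjSubmodule τ L (g ^ j)) :
    a * b - b * a ∈ conjSubmodule τ L (g ^ i) := by
  obtain ⟨y, hy, rfl⟩ := mem_conjSubmodule.1 ha
  obtain ⟨z, hz, rfl⟩ := mem_conjSubmodule.1 hb
  obtain ⟨u, hu⟩ := hL.exists_map_eq z hz
  have hu0 : (τ u - 1) * (τ u - 1) = 0 := by
    rw [hu, add_sub_cancel_left]; exact hL.mul_eq_zero _ hz _ hz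
  have hc (h k : G) (hk : k = h⁻¹) : τ (h * u * k) = 1 + τ h * z * τ k := by
    rw [map_mul, map_mul, hu, mul_add, mul_one, add_mul, ← map_mul, hk, mul_inv_cancel, map_one]
  have hinv (k : ℤ) : g ^ (-k) = (g ^ k)⁻¹ := zpow_neg g k
  have hs := hg u (hL.mem_conjStabilizer h2 hz hu) hu0 (j - i)
  have ht0 := sub_one_mul_self_conj hu0 (g ^ (j - i))
  rw [← hinv, hc _ _ (hinv _), add_sub_cancel_left] at ht0
  have h3 := ((mem_conjStabilizer_iff h2 (hc _ _ (hinv _)) ht0).1 hs y hy).1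
  refine mem_conjSubmodule.2 ⟨_, L.neg_mem h3, ?_⟩
  have e1 : g ^ (j - i) = (g ^ i)⁻¹ * g ^ j := by group
  have e2 : g ^ (-(j - i)) = (g ^ j)⁻¹ * g ^ i := by group
  have c1 (r : R) : τ (g ^ i) * (τ (g ^ i)⁻¹ * r) = r := by
    rw [← mul_assoc, ← map_mul, mul_inv_cancel, map_one, one_mul]
  have c2 : τ (g ^ i) * τ (g ^ i)⁻¹ = 1 := by rw [← map_mul, mul_inv_cancel, map_one]
  rw [e1, e2]
  simp only [map_mul, neg_sub, mul_sub, sub_mul, mul_assoc, c1, c2, mul_one]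

theorem IsOffenderSpace.exists_map_eq_of_mem_conjLimit (h2 : (2 : K) ≠ 0) (h3 : (3 : K) ≠ 0)
    (hL : IsOffenderSpace τ m L) (hgx : τ g = 1 + x) (hx : x * x = 0)
    (hg : ∀ u ∈ conjStabilizer τ L, (τ u - 1) * (τ u - 1) = 0 →
      ∀ i : ℤ, g ^ i * u * g ^ (-i) ∈ conjStabilizer τ L) {r : R} (hr : r ∈ conjLimit x L) :
    ∃ h, τ h = 1 + r := by
  have hrr : r * r = 0 :=
    mul_eq_zero_of_mem_initialForms (sub_mul_add_eq_X_sq hx) hL.mul_eq_zero hr hr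
  obtain ⟨a, ha, b, hb, c, hc, rfl⟩ := exists_of_mem_conjLimit hr
  have hmem (i : ℕ) (y : R) (hy : y ∈ L) : y + ((i : ℤ) : K) • (x * y - y * x) -
      ((i : ℤ) : K) ^ 2 • (x * y * x) ∈ conjSubmodule τ L (g ^ (i : ℤ)) := by
    rw [← map_zpow_conj hgx hx, zpow_neg]
    exact mem_conjSubmodule.2 ⟨y, hy, rfl⟩
  have m0 (y : R) (hy : y ∈ L) : y ∈ conjSubmodule τ L (g ^ ((0 : ℕ) : ℤ)) := by
    simpa using hmem 0 y hy
  have m1 (y : R) (hy : y ∈ L) : y + (x * y - y * x) - x * y * x ∈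
      conjSubmodule τ L (g ^ ((1 : ℕ) : ℤ)) := by
    simpa using hmem 1 y hy
  have m2 (y : R) (hy : y ∈ L) : y + (2 : K) • (x * y - y * x) - (2 : K) ^ 2 • (x * y * x) ∈
      conjSubmodule τ L (g ^ ((2 : ℕ) : ℤ)) := by
    have := hmem 2 y hy
    push_cast at this ⊢
    exact this
  have hr' : a + (x * b - b * x) - x * c * x =
      (a - (3 * 2⁻¹ : K) • b + (2 : K)⁻¹ • c) +
      ((2 : K) • (b + (x * b - b * x) - x * b * x) - (c + (x * c - c * x) - x * c * x)) +
      (2 : K)⁻¹ • ((c + (2 : K) • (x * c - c * x) - (2 : K) ^ 2 • (x * c * x)) -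
        (b + (2 : K) • (x * b - b * x) - (2 : K) ^ 2 • (x * b * x))) := by
    match_scalars <;> field_simp <;> ring
  rw [hr'] at hrr ⊢
  have hinv (i : G) : τ i⁻¹ * τ i = 1 := by rw [← map_mul, inv_mul_cancel, map_one]
  refine MonoidHom.mem_mrange.1 (one_add_mem_of_mul_self_eq_zero h2 h3
    (L := fun i : ℕ => conjSubmodule τ L (g ^ (i : ℤ))) (fun i y hy z hz => ?_)
    (fun i j y hy z hz => hL.commutator_mem_conjSubmodule h2 hg i j hy hz) (fun i y hy => ?_)
    ?_ ?_ ?_ hrr)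
  · obtain ⟨y, hy', rfl⟩ := mem_conjSubmodule.1 hy
    obtain ⟨z, hz', rfl⟩ := mem_conjSubmodule.1 hz
    calc _ = τ (g ^ (i : ℤ)) * (y * (τ (g ^ (i : ℤ))⁻¹ * τ (g ^ (i : ℤ))) * z) *
          τ (g ^ (i : ℤ))⁻¹ := by simp only [mul_assoc]
      _ = 0 := by rw [hinv, mul_one, hL.mul_eq_zero y hy' z hz', mul_zero, zero_mul]
  · obtain ⟨y, hy', rfl⟩ := mem_conjSubmodule.1 hy
    obtain ⟨u, hu⟩ := hL.exists_map_eq y hy'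
    refine MonoidHom.mem_mrange.2 ⟨g ^ (i : ℤ) * u * (g ^ (i : ℤ))⁻¹, ?_⟩
    rw [map_mul, map_mul, hu, mul_add, mul_one, add_mul, ← map_mul, mul_inv_cancel, map_one]
  · exact Submodule.add_mem _ (Submodule.sub_mem _ (m0 _ ha) (m0 _ (L.smul_mem _ hb)))
      (m0 _ (L.smul_mem _ hc))
  · exact Submodule.sub_mem _ (Submodule.smul_mem _ _ (m1 _ hb)) (m1 _ hc)
  · exact Submodule.smul_mem _ _ (Submodule.sub_mem _ (m2 _ hc) (m2 _ hb))

theorem IsOffenderSpace.conjLimit [FiniteDimensional K R] (h2 : (2 : K) ≠ 0) (h3 : (3 : K) ≠ 0)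
    (hL : IsOffenderSpace τ m L) (hgx : τ g = 1 + x) (hx : x * x = 0)
    (hg : ∀ u ∈ conjStabilizer τ L, (τ u - 1) * (τ u - 1) = 0 →
      ∀ i : ℤ, g ^ i * u * g ^ (-i) ∈ conjStabilizer τ L) :
    IsOffenderSpace τ m (conjLimit x L) where
  mul_eq_zero _ ha _ hb :=
    mul_eq_zero_of_mem_initialForms (sub_mul_add_eq_X_sq hx) hL.mul_eq_zero ha hb
  exists_map_eq _ hr := hL.exists_map_eq_of_mem_conjLimit h2 h3 hgx hx hg hr
  ne_bot h := by
    have h1 : finrank K L ≤ finrank K (_root_.conjLimit x L) :=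
      finrank_le_finrank_initialForms (sub_mul_add_eq_X_sq hx) (sub_mul_add_eq_X_sq hx) L
    rw [h, finrank_bot, Nat.le_zero, Submodule.finrank_eq_zero] at h1
    exact hL.ne_bot h1
  finrank_le := hL.finrank_le_conjLimit hx

theorem mem_conjStabilizer_conjLimit_self (h2 : (2 : K) ≠ 0) (hgx : τ g = 1 + x)
    (hx : x * x = 0) : g ∈ conjStabilizer τ (conjLimit x L) :=
  (mem_conjStabilizer_iff h2 hgx hx).2 fun _ hy =>
    ⟨commutator_mem_conjLimit hx hy, mul_mul_mem_conjLimit h2 hx hy⟩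

theorem mem_conjStabilizer_conjLimit (h2 : (2 : K) ≠ 0) (h3 : (3 : K) ≠ 0) (hgx : τ g = 1 + x)
    (hx : x * x = 0) {u : G} (hu : (τ u - 1) * (τ u - 1) = 0)
    (hg : ∀ i : ℤ, g ^ i * u * g ^ (-i) ∈ conjStabilizer τ L) :
    u ∈ conjStabilizer τ (conjLimit x L) := by
  rw [mem_conjStabilizer_iff h2 (add_sub_cancel _ _).symm hu]
  refine fun y hy => mem_conjLimit_of_forall_int h2 h3 hx (fun i z hz v hv => ?_) hy
  have h4 : τ (g ^ (-i) * u * g ^ (- -i)) = 1 + v := by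
    have h5 := map_zpow_conj (K := K) hgx hx (-i) (τ u - 1)
    rw [hv, map_mul, map_mul]
    have h6 : τ (g ^ (-i)) * τ (g ^ (- -i)) = 1 := by rw [← map_mul, zpow_neg g (-i),
      mul_inv_cancel, map_one]
    rw [mul_sub, sub_mul, mul_one, h6, sub_eq_iff_eq_add'] at h5
    rw [h5]
    push_cast
    module
  have h5 : v * v = 0 := by
    have := sub_one_mul_self_conj hu (g ^ (-i))
    rwa [← zpow_neg, h4, add_sub_cancel_left] at this
  exact (mem_conjStabilizer_iff h2 h4 h5).1 (hg (-i)) z hz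

theorem exists_notMem_conj_mem_closure [Group.IsNilpotent G] {D : Set G}
    (hD : ∀ u ∈ D, ∀ h : G, h * u * h⁻¹ ∈ D) {N : Subgroup G} (hDN : ¬ D ⊆ N) :
    ∃ g ∈ D, g ∉ N ∧ ∀ u ∈ N, u ∈ D → ∀ i : ℤ, g ^ i * u * g ^ (-i) ∈ N := by
  set P := Subgroup.closure (D ∩ N) with hP
  have hPN : P ≤ N := (Subgroup.closure_le N).2 Set.inter_subset_right
  have hPD : D ∩ N ⊆ P := Subgroup.subset_closure
  obtain ⟨g, hgD, hgP, hgN⟩ : ∃ g ∈ D, g ∈ Subgroup.normalizer (P : Set G) ∧ g ∉ N := by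
    by_contra! h
    have h1 : Subgroup.normalizer ((Subgroup.normalizer (P : Set G) : Subgroup G) : Set G) =
        Subgroup.normalizer (P : Set G) := by
      refine le_antisymm (fun g hg => ?_) Subgroup.le_normalizer
      have conj_mem (k : G) (hk : k ∈ Subgroup.normalizer
          ((Subgroup.normalizer (P : Set G) : Subgroup G) : Set G)) :
          P ≤ P.comap (MulAut.conj k).toMonoidHom := by
        refine (Subgroup.closure_le _).2 fun u hu => hPD ⟨hD u hu.1 k, h _ (hD u hu.1 k) ?_⟩
        exact (Subgroup.mem_normalizer_iff.1 hk u).1 (Subgroup.le_normalizer (hPD hu))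
      refine Subgroup.mem_normalizer_iff.2 fun u => ⟨fun hu => conj_mem g hg hu, fun hu => ?_⟩
      have := conj_mem g⁻¹ (inv_mem hg) hu
      simpa [mul_assoc] using this
    have h2 := normalizerCondition_iff_only_full_group_self_normalizing.1
      Group.normalizerCondition_of_isNilpotent _ h1
    exact hDN fun u hu => h u hu (h2 ▸ Subgroup.mem_top u)
  refine ⟨g, hgD, hgN, fun u hu huD i => hPN ?_⟩
  rw [zpow_neg]
  exact (Subgroup.mem_normalizer_iff.1 (zpow_mem hgP i) u).1 (hPD ⟨huD, hu⟩)

theorem exists_isOffenderSpace_conjStabilizer [FiniteDimensional K R] [Finite G]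
    [Group.IsNilpotent G] (h2 : (2 : K) ≠ 0) (h3 : (3 : K) ≠ 0) (hL : IsOffenderSpace τ m L) :
    ∃ M : Submodule K R, IsOffenderSpace τ m M ∧
      ∀ g, (τ g - 1) * (τ g - 1) = 0 → g ∈ conjStabilizer τ M := by
  let D : Set G := {g | (τ g - 1) * (τ g - 1) = 0}
  have hbdd : {k | ∃ M : Submodule K R, IsOffenderSpace τ m M ∧
      (D ∩ conjStabilizer τ M).ncard = k}.Finite :=
    (Set.finite_le_nat (Nat.card G)).subset fun k ⟨M, _, hk⟩ =>
      hk ▸ Set.ncard_le_card _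
  obtain ⟨_, ⟨M, hM, rfl⟩, hmax⟩ := hbdd.exists_maximal ⟨_, L, hL, rfl⟩
  refine ⟨M, hM, ?_⟩
  by_contra h
  obtain ⟨g, hgD, hgM, hg⟩ := exists_notMem_conj_mem_closure (D := D) (N := conjStabilizer τ M)
    (fun u hu => sub_one_mul_self_conj hu) h
  have hgx : τ g = 1 + (τ g - 1) := (add_sub_cancel _ _).symm
  have h4 := hM.conjLimit h2 h3 hgx hgD hg
  have h5 : (D ∩ conjStabilizer τ M).ncard <
      (D ∩ conjStabilizer τ (conjLimit (τ g - 1) M)).ncard := by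
    refine Set.ncard_lt_ncard ⟨fun u hu => ⟨hu.1, ?_⟩, fun hsub => ?_⟩
    · exact mem_conjStabilizer_conjLimit h2 h3 hgx hgD hu.1 (hg u hu.2 hu.1)
    · exact hgM (hsub ⟨hgD, mem_conjStabilizer_conjLimit_self h2 hgx hgD⟩).2
  exact absurd (hmax ⟨_, h4, rfl⟩ h5.le) (not_le_of_gt h5)

end Representation

section Nilpotent

variable {K R : Type*} [CommRing K] [Ring R] [Algebra K R]

theorem Commute.of_mem_span {s : Set R} {a b : R} (h : ∀ c ∈ s, Commute a c)
    (hb : b ∈ Submodule.span K s) : Commute a b := by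
  induction hb using Submodule.span_induction with
  | mem c hc => exact h c hc
  | zero => exact Commute.zero_right a
  | add b c _ _ hb hc => exact hb.add_right hc
  | smul k b _ hb => exact hb.smul_right k

theorem IsNilpotent.of_mem_span {s : Set R} (hs : ∀ a ∈ s, IsNilpotent a)
    (hc : ∀ a ∈ s, ∀ b ∈ s, Commute a b) {a : R} (ha : a ∈ Submodule.span K s) :
    IsNilpotent a := by
  induction ha using Submodule.span_induction with
  | mem a ha => exact hs a ha
  | zero => exact IsNilpotent.zero
  | add a b ha hb iha ihb =>
    refine Commute.isNilpotent_add (.of_mem_span (fun c hcs => ?_) hb) iha ihb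
    exact (Commute.of_mem_span (fun d hd => hc c hcs d hd) ha).symm
  | smul k a _ iha => exact iha.smul k

end Nilpotent

section Offender

variable {p : ℕ} [Fact p.Prime] {V : Type*} [AddCommGroup V] [Module (ZMod p) V]
  {G : Type*} [Group G]

/-- The subspace of vectors fixed by every element of `E`. -/
def fixedSubspace (τ : G →* Module.End (ZMod p) V) (E : Subgroup G) : Submodule (ZMod p) V where
  carrier := {v | ∀ g ∈ E, τ g v = v}
  zero_mem' := fun g _ => map_zero _
  add_mem' := fun ha hb g hg => by rw [map_add, ha g hg, hb g hg]
  smul_mem' := fun c v hv g hg => by rw [map_smul, hv g hg]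

/-- Elementary abelian offenders on `V`. -/
structure IsOffender (τ : G →* Module.End (ZMod p) V) (E : Subgroup G) : Prop where
  ne_bot : E ≠ ⊥
  comm : ∀ x ∈ E, ∀ y ∈ E, x * y = y * x
  pow_eq_one : ∀ x ∈ E, x ^ p = 1
  natCard_le : Nat.card V ≤ Nat.card E * Nat.card (fixedSubspace τ E)

/-- The common kernel of a space of endomorphisms. -/
def commonKernel (L : Submodule (ZMod p) (Module.End (ZMod p) V)) : Submodule (ZMod p) V :=
  ⨅ t ∈ L, LinearMap.ker t

variable {τ : G →* Module.End (ZMod p) V} {E : Subgroup G}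
  {L : Submodule (ZMod p) (Module.End (ZMod p) V)}

theorem mem_commonKernel {v : V} : v ∈ commonKernel L ↔ ∀ t ∈ L, t v = 0 := by
  simp [commonKernel]

theorem finrank_rightAnnihilator [Finite V] :
    finrank (ZMod p) (rightAnnihilator L) =
      finrank (ZMod p) V * finrank (ZMod p) (commonKernel L) := by
  have hinj : Function.Injective
      (LinearMap.compRight (ZMod p) (M := V) (commonKernel L).subtype) := fun f g hfg =>
    LinearMap.ext fun v => Subtype.ext (LinearMap.congr_fun hfg v)
  have h : rightAnnihilator L =
      LinearMap.range (LinearMap.compRight (ZMod p) (M := V) (commonKernel L).subtype) := by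
    ext z
    refine ⟨fun hz => ?_, ?_⟩
    · refine ⟨z.codRestrict _ fun v => mem_commonKernel.2 fun t ht => ?_, rfl⟩
      exact LinearMap.congr_fun (hz t ht) v
    · rintro ⟨f, rfl⟩ t ht
      exact LinearMap.ext fun v => mem_commonKernel.1 (f v).2 t ht
  rw [h, LinearMap.finrank_range_of_inj hinj, Module.finrank_linearMap]

theorem fixedSubspace_eq_commonKernel (hsurj : ∀ t ∈ L, ∃ g, τ g = 1 + t)
    (hEL : ∀ g, g ∈ E ↔ τ g - 1 ∈ L) : fixedSubspace τ E = commonKernel L := by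
  ext v
  rw [mem_commonKernel]
  refine ⟨fun hv t ht => ?_, fun hv g hg => ?_⟩
  · obtain ⟨g, hg⟩ := hsurj t ht
    have := hv g ((hEL g).2 (by rwa [hg, add_sub_cancel_left]))
    simpa [hg] using this
  · simpa [sub_eq_zero] using hv _ ((hEL g).1 hg)

theorem natCard_eq_of_mem_iff (hτ : Function.Injective τ) (hsurj : ∀ t ∈ L, ∃ g, τ g = 1 + t)
    (hEL : ∀ g, g ∈ E ↔ τ g - 1 ∈ L) : Nat.card E = Nat.card L := by
  refine Nat.card_congr (Equiv.ofBijective (fun g => ⟨τ g - 1, (hEL g).1 g.2⟩) ⟨?_, ?_⟩)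
  · intro g h hgh
    exact Subtype.ext (hτ (sub_left_injective (congrArg Subtype.val hgh)))
  · rintro ⟨t, ht⟩
    obtain ⟨g, hg⟩ := hsurj t ht
    have h : τ g - 1 = t := by rw [hg, add_sub_cancel_left]
    exact ⟨⟨g, (hEL g).2 (h ▸ ht)⟩, Subtype.ext h⟩

theorem natCard_le_iff_finrank_le [Finite V] [Nontrivial V] (hτ : Function.Injective τ)
    (hsurj : ∀ t ∈ L, ∃ g, τ g = 1 + t) (hEL : ∀ g, g ∈ E ↔ τ g - 1 ∈ L) :
    Nat.card V ≤ Nat.card E * Nat.card (fixedSubspace τ E) ↔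
      finrank (ZMod p) (Module.End (ZMod p) V) ≤
        finrank (ZMod p) V * finrank (ZMod p) L + finrank (ZMod p) (rightAnnihilator L) := by
  rw [natCard_eq_of_mem_iff hτ hsurj hEL, fixedSubspace_eq_commonKernel hsurj hEL,
    finrank_rightAnnihilator, ← mul_add, Module.finrank_linearMap,
    Nat.mul_le_mul_left_iff Module.finrank_pos,
    Module.natCard_eq_pow_finrank (K := ZMod p) (V := V),
    Module.natCard_eq_pow_finrank (K := ZMod p) (V := L),
    Module.natCard_eq_pow_finrank (K := ZMod p) (V := commonKernel L), ← pow_add, Nat.card_zmod,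
    Nat.pow_le_pow_iff_right (Fact.out : p.Prime).one_lt]

theorem IsOffender.exists_isOffenderSpace [Finite V] (hτ : Function.Injective τ)
    (hE : IsOffender τ E) (hquad : ∀ g ∈ E, ∀ h ∈ E, (τ g - 1) * (τ h - 1) = 0) :
    ∃ L : Submodule (ZMod p) (Module.End (ZMod p) V),
      IsOffenderSpace τ (finrank (ZMod p) V) L := by
  have hV : Nontrivial V := by
    obtain ⟨g, hg, hg1⟩ := (Subgroup.ne_bot_iff_exists_ne_one.1 hE.ne_bot).imp fun g hg =>
      And.intro g.2 fun h => hg (Subtype.ext h)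
    by_contra hV
    rw [not_nontrivial_iff_subsingleton] at hV
    exact hg1 (hτ (LinearMap.ext fun v => Subsingleton.elim _ _))
  let L : Submodule (ZMod p) (Module.End (ZMod p) V) :=
    { carrier := {t | ∃ g ∈ E, τ g = 1 + t}
      zero_mem' := ⟨1, E.one_mem, by simp⟩
      add_mem' := by
        rintro s t ⟨g, hg, hs⟩ ⟨h, hh, ht⟩
        refine ⟨g * h, E.mul_mem hg hh, ?_⟩
        have := hquad g hg h hh
        rw [hs, ht, add_sub_cancel_left, add_sub_cancel_left] at this
        rw [map_mul, hs, ht, add_mul, mul_add, mul_add, this]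
        simp only [mul_one, one_mul]
        abel
      smul_mem' := by
        rintro k t ⟨g, hg, ht⟩
        have h0 := hquad g hg g hg
        rw [ht, add_sub_cancel_left] at h0
        refine ⟨g ^ (k.val : ℤ), E.zpow_mem hg _, ?_⟩
        rw [map_zpow_eq_one_add_smul (K := ZMod p) ht h0]
        simp }
  have hL (t) : t ∈ L ↔ ∃ g ∈ E, τ g = 1 + t := Iff.rfl
  have hsurj : ∀ t ∈ L, ∃ g, τ g = 1 + t := fun t ⟨g, _, hg⟩ => ⟨g, hg⟩
  have hEL (g : G) : g ∈ E ↔ τ g - 1 ∈ L := by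
    rw [hL, add_sub_cancel]
    exact ⟨fun hg => ⟨g, hg, rfl⟩, fun ⟨h, hh, e⟩ => hτ e ▸ hh⟩
  refine ⟨L, fun s hs t ht => ?_, hsurj, fun h => hE.ne_bot ?_,
    (natCard_le_iff_finrank_le hτ hsurj hEL).1 hE.natCard_le⟩
  · obtain ⟨g, hg, hs⟩ := (hL s).1 hs
    obtain ⟨h, hh, ht⟩ := (hL t).1 ht
    simpa only [hs, ht, add_sub_cancel_left] using hquad g hg h hh
  · refine (Subgroup.eq_bot_iff_forall _).2 fun g hg => hτ ?_
    rwa [hEL, h, Submodule.mem_bot, sub_eq_zero, ← map_one τ] at hg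

theorem IsOffenderSpace.exists_isOffender [Finite V] [Nontrivial V] (hτ : Function.Injective τ)
    (hL : IsOffenderSpace τ (finrank (ZMod p) V) L) :
    ∃ E : Subgroup G, (∀ g, g ∈ E ↔ τ g - 1 ∈ L) ∧ IsOffender τ E := by
  have hmul (s t) (hs : s ∈ L) (ht : t ∈ L) : (1 + s) * (1 + t) = 1 + (s + t) := by
    rw [add_mul, mul_add, mul_add, hL.mul_eq_zero s hs t ht]
    simp only [mul_one, one_mul]
    abel
  have hg1 (g : G) : τ g = 1 + (τ g - 1) := (add_sub_cancel _ _).symm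
  let E : Subgroup G :=
    { carrier := {g | τ g - 1 ∈ L}
      one_mem' := by simp
      mul_mem' := fun {g h} hg hh => by
        change τ (g * h) - 1 ∈ L
        rw [map_mul, hg1 g, hg1 h, hmul _ _ hg hh, add_sub_cancel_left]
        exact L.add_mem hg hh
      inv_mem' := fun {g} hg => by
        change τ g⁻¹ - 1 ∈ L
        rw [map_inv_eq_one_sub (hg1 g) (hL.mul_eq_zero _ hg _ hg), sub_sub_cancel_left]
        exact L.neg_mem hg }
  have hEL (g : G) : g ∈ E ↔ τ g - 1 ∈ L := Iff.rfl
  refine ⟨E, hEL, fun h => hL.ne_bot ?_, fun g hg h hh => hτ ?_, fun g hg => hτ ?_,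
    (natCard_le_iff_finrank_le hτ hL.exists_map_eq hEL).2 hL.finrank_le⟩
  · refine (Submodule.eq_bot_iff _).2 fun t ht => ?_
    obtain ⟨g, hg⟩ := hL.exists_map_eq t ht
    have h1 : g ∈ E := by rwa [hEL, hg, add_sub_cancel_left]
    rw [h, Subgroup.mem_bot] at h1
    simpa [h1] using hg
  · rw [map_mul, map_mul, hg1 g, hg1 h, hmul _ _ hg hh, hmul _ _ hh hg, add_comm (τ g - 1)]
  · have := map_zpow_eq_one_add_smul (K := ZMod p) (hg1 g) (hL.mul_eq_zero _ hg _ hg) p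
    simpa using this

theorem subgroupOf_normalClosure_normal (hEL : ∀ g, g ∈ E ↔ τ g - 1 ∈ L)
    (hLL : ∀ a ∈ L, ∀ b ∈ L, a * b = 0)
    (hL : ∀ g, (τ g - 1) * (τ g - 1) = 0 → g ∈ conjStabilizer τ L) :
    (E.subgroupOf (Subgroup.normalClosure (E : Set G))).Normal := by
  have hle : Subgroup.normalClosure (E : Set G) ≤ conjStabilizer τ L := by
    refine (Subgroup.closure_le _).2 fun g hg => hL g ?_
    obtain ⟨e, he, hc⟩ := Group.mem_conjugatesOfSet_iff.1 hg
    obtain ⟨h, rfl⟩ := isConj_iff.1 hc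
    have := (hEL e).1 he
    exact sub_one_mul_self_conj (hLL _ this _ this) h
  refine ⟨fun e he n => ?_⟩
  rw [Subgroup.mem_subgroupOf, hEL] at he ⊢
  have h1 := (hle n.2 _ he).1
  have h2 : τ (n : G) * τ (n : G)⁻¹ = 1 := by rw [← map_mul, mul_inv_cancel, map_one]
  rw [mul_sub, sub_mul, mul_one, h2] at h1
  simpa only [Subgroup.coe_mul, InvMemClass.coe_inv, map_mul] using h1

/-- The span of the vectors `g • v - v` for `g ∈ E`. -/
def commutatorSubspace (τ : G →* Module.End (ZMod p) V) (E : Subgroup G) (v : V) :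
    Submodule (ZMod p) V :=
  Submodule.span (ZMod p) ((fun g => τ g v - v) '' E)

theorem mem_fixedSubspace_of_mem_sup (hE : ∀ x ∈ E, ∀ y ∈ E, x * y = y * x)
    (hp : ∀ x ∈ E, x ^ p = 1) {v : V}
    (hv : v ∈ commutatorSubspace τ E v ⊔ fixedSubspace τ E) : v ∈ fixedSubspace τ E := by
  rcases subsingleton_or_nontrivial V with hV | hV
  · exact fun g _ => Subsingleton.elim _ _
  have hchar : CharP (Module.End (ZMod p) V) p :=
    charP_of_injective_algebraMap (algebraMap (ZMod p) (Module.End (ZMod p) V)).injective p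
  have hcomm (g) (hg : g ∈ E) (h) (hh : h ∈ E) : Commute (τ g) (τ h - 1) := by
    refine Commute.sub_right ?_ (Commute.one_right _)
    rw [Commute, SemiconjBy, ← map_mul, ← map_mul, hE g hg h hh]
  obtain ⟨w, hw, c, hc, hwc⟩ := Submodule.mem_sup.1 hv
  obtain ⟨i, hi, rfl⟩ : ∃ i ∈ Submodule.span (ZMod p) ((fun g => τ g - 1) '' (E : Set G)),
      i v = w := by
    have h : commutatorSubspace τ E v =
        (Submodule.span (ZMod p) ((fun g => τ g - 1) '' (E : Set G))).map
          (LinearMap.applyₗ v) := by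
      rw [Submodule.map_span, Set.image_image]
      simp [commutatorSubspace]
    rw [h] at hw
    exact hw
  have hnil : IsNilpotent i := by
    refine IsNilpotent.of_mem_span ?_ ?_ hi
    · rintro _ ⟨g, hg, rfl⟩
      refine ⟨p, ?_⟩
      rw [sub_pow_char_of_commute p (Commute.one_right _), ← map_pow, hp g hg, map_one, one_pow,
        sub_self]
    · rintro _ ⟨g, hg, rfl⟩ _ ⟨h, hh, rfl⟩
      exact (hcomm g hg h hh).sub_left (Commute.one_left _)
  have hinj := ((Module.End.isUnit_iff _).1 hnil.isUnit_one_sub).1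
  intro g hg
  refine hinj ?_
  have hgi : Commute (τ g) i := .of_mem_span (by rintro _ ⟨h, hh, rfl⟩; exact hcomm g hg h hh) hi
  have hic : (1 - i) v = c := sub_eq_of_eq_add' hwc.symm
  calc (1 - i) (τ g v) = τ g ((1 - i) v) :=
        (LinearMap.congr_fun ((Commute.one_right _).sub_right hgi).eq v).symm
    _ = (1 - i) v := by rw [hic, hc g hg]

theorem natCard_mul_natCard_le [Finite V] [Finite G] (hE : ∀ x ∈ E, ∀ y ∈ E, x * y = y * x)
    {F : Subgroup G} (hFE : F ≤ E) {v : V}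
    (hF : ∀ g ∈ E, (∀ w ∈ commutatorSubspace τ E v, τ g w = w) → g ∈ F) :
    Nat.card E * Nat.card (fixedSubspace τ E) ≤
      Nat.card F * Nat.card ↥(commutatorSubspace τ E v ⊔ fixedSubspace τ E) := by
  have hmem (g) (hg : g ∈ E) : τ g v - v ∈ commutatorSubspace τ E v :=
    Submodule.subset_span ⟨g, hg, rfl⟩
  have hdiff (g) (hg : g ∈ E) (h) (hh : h ∈ E) (hgh : τ g v - τ h v ∈ fixedSubspace τ E) :
      h⁻¹ * g ∈ F := by
    have hd : τ (h⁻¹ * g) v - v ∈ fixedSubspace τ E := by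
      have h1 := hgh h⁻¹ (inv_mem hh)
      have h2 : τ h⁻¹ (τ h v) = v := by
        rw [← Module.End.mul_apply, ← map_mul, inv_mul_cancel, map_one, Module.End.one_apply]
      rw [map_sub, h2, ← Module.End.mul_apply, ← map_mul] at h1
      rwa [h1]
    have hdE := E.mul_mem (inv_mem hh) hg
    refine hF _ hdE fun w hw => ?_
    induction hw using Submodule.span_induction with
    | mem w hw =>
      obtain ⟨a, ha, rfl⟩ := hw
      have h3 := hd a ha
      have h4 : τ (h⁻¹ * g) (τ a v) = τ a (τ (h⁻¹ * g) v) := by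
        rw [← Module.End.mul_apply, ← Module.End.mul_apply, ← map_mul, ← map_mul, hE _ hdE a ha]
      rw [map_sub] at h3
      rw [map_sub, h4, sub_eq_sub_iff_sub_eq_sub, h3]
    | zero => exact map_zero _
    | add w z _ _ hw hz => rw [map_add, hw, hz]
    | smul k w _ hw => rw [map_smul, hw]
  have hle : Nat.card (E ⧸ F.subgroupOf E) * Nat.card (fixedSubspace τ E) ≤
      Nat.card ↥(commutatorSubspace τ E v ⊔ fixedSubspace τ E) := by
    rw [← Nat.card_prod]
    refine Nat.card_le_card_of_injective
      (fun q : (E ⧸ F.subgroupOf E) × fixedSubspace τ E =>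
        (⟨(τ (q.1.out : E) v - v) + q.2, Submodule.add_mem_sup (hmem _ q.1.out.2) q.2.2⟩ :
          ↥(commutatorSubspace τ E v ⊔ fixedSubspace τ E))) ?_
    rintro ⟨q, c⟩ ⟨r, d⟩ h
    have h1 : (τ (q.out : E) v - v) + (c : V) = (τ (r.out : E) v - v) + d :=
      congrArg Subtype.val h
    have h2 : τ (r.out : E) v - τ (q.out : E) v = (c : V) - d := by
      rw [← sub_sub_sub_cancel_right _ _ v, sub_eq_sub_iff_add_eq_add, ← h1, add_comm]
    have h3 : q = r := by
      rw [← q.out_eq', ← r.out_eq']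
      refine QuotientGroup.eq.2 (hdiff _ r.out.2 _ q.out.2 ?_)
      rw [h2]
      exact Submodule.sub_mem _ c.2 d.2
    subst h3
    exact Prod.ext rfl (Subtype.ext (add_left_cancel h1))
  rw [Subgroup.card_eq_card_quotient_mul_card_subgroup (F.subgroupOf E),
    Nat.card_congr (Subgroup.subgroupOfEquivOfLe hFE).toEquiv, mul_right_comm, mul_comm]
  exact Nat.mul_le_mul_left _ hle

/-- **Thompson replacement**: an offender of minimal order acts quadratically. -/
theorem IsOffender.exists_quadratic [Finite V] [Finite G] (hE : IsOffender τ E) :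
    ∃ E : Subgroup G, IsOffender τ E ∧ ∀ g ∈ E, ∀ h ∈ E, (τ g - 1) * (τ h - 1) = 0 := by
  obtain ⟨_, ⟨A, hA, rfl⟩, hmin⟩ := WellFounded.has_min (wellFounded_lt (α := ℕ))
    {n | ∃ A : Subgroup G, IsOffender τ A ∧ Nat.card A = n} ⟨_, E, hE, rfl⟩
  refine ⟨A, hA, fun g hg h hh => LinearMap.ext fun v => ?_⟩
  by_contra hv
  set M := commutatorSubspace τ A v with hM
  let F : Subgroup G := A ⊓
    { carrier := {g | ∀ w ∈ M, τ g w = w}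
      one_mem' := by simp
      mul_mem' := fun {a b} ha hb w hw => by
        rw [map_mul, Module.End.mul_apply, hb w hw, ha w hw]
      inv_mem' := fun {a} ha w hw => by
        conv_lhs => rw [← ha w hw]
        rw [← Module.End.mul_apply, ← map_mul, inv_mul_cancel, map_one, Module.End.one_apply] }
  have hFA : F ≤ A := inf_le_left
  have hgF : g ∉ F := fun hgF => hv (by
    have := hgF.2 _ (Submodule.subset_span ⟨h, hh, rfl⟩)
    simpa [sub_eq_zero] using this)
  have hcard := hA.natCard_le.trans
    (natCard_mul_natCard_le hA.comm hFA fun a ha hw => ⟨ha, hw⟩)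
  by_cases hF : F = ⊥
  · rw [hF, Subgroup.card_bot, one_mul] at hcard
    have htop : commutatorSubspace τ A v ⊔ fixedSubspace τ A = ⊤ :=
      Submodule.toAddSubgroup_injective (AddSubgroup.eq_top_of_le_card _ hcard)
    have := mem_fixedSubspace_of_mem_sup hA.comm hA.pow_eq_one (htop ▸ Submodule.mem_top (x := v))
    exact hv (by simp [this h hh])
  · refine hmin _ ⟨F, ⟨hF, fun a ha b hb => hA.comm a ha.1 b hb.1,
      fun a ha => hA.pow_eq_one a ha.1, hcard.trans (Nat.mul_le_mul_left _ ?_)⟩, rfl⟩ ?_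
    · refine Nat.card_le_card_of_injective _
        (Submodule.inclusion_injective (sup_le (fun w hw a ha => ha.2 w hw) fun w hw a ha =>
          hw a ha.1))
    · exact Set.ncard_lt_ncard ⟨hFA, fun hAF => hgF (hAF hg)⟩ (Set.toFinite _)

end Offender

end QuadraticOffender

/-!
STATEMENT 2 (Theorem C):
Suppose `p ≥ 5` is a prime.  Let `V` be a finite elementary abelian `p`-group which
is an F-module for the finite `p`-group `G` (acting faithfully via `ρ`).  Then there
exists an offender `E ≤ G` which acts quadratically on `V` and which is normal in
its normal closure `⟨E^G⟩` in `G` (i.e. `E` is 2-subnormal in `G`).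
-/

theorem exists_two_subnormal_quadratic_offender
    (p : ℕ) [Fact p.Prime] (hp : 5 ≤ p)
    (V : Type) [AddCommGroup V] [Module (ZMod p) V] [Finite V]
    (G : Type) [Group G] [Finite G] (hGp : IsPGroup p G)
    (ρ : G →* (V ≃ₗ[ZMod p] V)) (hfaithful : Function.Injective ρ)
    -- `V` is an F-module for `G`: there is an offender
    (hF : ∃ E : Subgroup G, E ≠ ⊥ ∧ (∀ x ∈ E, ∀ y ∈ E, x * y = y * x) ∧
      (∀ x ∈ E, x ^ p = 1) ∧
      Nat.card V ≤ Nat.card E * Nat.card {v : V | ∀ g ∈ E, ρ g v = v}) :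
    -- there is a quadratic offender `E` normal in its normal closure in `G`
    ∃ E : Subgroup G,
      -- `E` is an offender:
      (E ≠ ⊥ ∧ (∀ x ∈ E, ∀ y ∈ E, x * y = y * x) ∧ (∀ x ∈ E, x ^ p = 1) ∧
        Nat.card V ≤ Nat.card E * Nat.card {v : V | ∀ g ∈ E, ρ g v = v}) ∧
      -- `E` acts quadratically on `V`: `(g−1)(h−1) = 0` for all `g, h ∈ E`, and
      -- `E` does not act trivially on `V`
      ((∀ g ∈ E, ∀ h ∈ E,
          ((ρ g : Module.End (ZMod p) V) - 1) * ((ρ h : Module.End (ZMod p) V) - 1) = 0) ∧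
        ¬ ∀ g ∈ E, ∀ v : V, ρ g v = v) ∧
      -- `E` is normal in its normal closure `⟨E^G⟩`
      (E.subgroupOf (Subgroup.normalClosure (E : Set G))).Normal := by
  let τ : G →* Module.End (ZMod p) V := LinearEquiv.automorphismGroup.toLinearMapMonoidHom.comp ρ
  have hτ : Function.Injective τ := LinearEquiv.toLinearMap_injective.comp hfaithful
  have two_ne : (2 : ZMod p) ≠ 0 := by
    have h := (ZMod.natCast_eq_zero_iff 2 p).not.2 fun h => by
      have := Nat.le_of_dvd two_pos h; omega
    exact_mod_cast h
  have three_ne : (3 : ZMod p) ≠ 0 := by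
    have h := (ZMod.natCast_eq_zero_iff 3 p).not.2 fun h => by
      have := Nat.le_of_dvd three_pos h; omega
    exact_mod_cast h
  have hnil : Group.IsNilpotent G := hGp.isNilpotent
  obtain ⟨A, hA1, hA2, hA3, hA4⟩ := hF
  have hA : IsOffender τ A := ⟨hA1, hA2, hA3, hA4⟩
  obtain ⟨B, hB, hBquad⟩ := hA.exists_quadratic
  obtain ⟨L₀, hL₀⟩ := hB.exists_isOffenderSpace hτ hBquad
  obtain ⟨L, hL, hstab⟩ := exists_isOffenderSpace_conjStabilizer two_ne three_ne hL₀
  obtain ⟨t, ht, ht0⟩ := L.exists_mem_ne_zero_of_ne_bot hL.ne_bot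
  have hV : Nontrivial V := by
    obtain ⟨v, hv⟩ := DFunLike.ne_iff.1 ht0
    exact ⟨t v, 0, hv⟩
  obtain ⟨E, hEL, hE⟩ := hL.exists_isOffender hτ
  refine ⟨E, ⟨hE.ne_bot, hE.comm, hE.pow_eq_one, hE.natCard_le⟩,
    ⟨fun g hg h hh => hL.mul_eq_zero _ ((hEL g).1 hg) _ ((hEL h).1 hh), fun htriv => ?_⟩,
    subgroupOf_normalClosure_normal hEL hL.mul_eq_zero hstab⟩
  obtain ⟨g, hg⟩ := hL.exists_map_eq t ht
  have hgE : g ∈ E := (hEL g).2 (by rwa [hg, add_sub_cancel_left])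
  have h1 : τ g = 1 := LinearMap.ext (htriv g hgE)
  exact ht0 (by simpa [h1] using hg)
end
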